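/- arXiv:2502.10041 — 2 statements merged into one kernel-verified Lean document; each statement's English description precedes it below -/
import Mathlib

section
/- Let (λ_n)_{n≥1} be a Landau system. Then there exists a nonnegative Schwartz function g on ℝ such that for every positive integer N and every p > 1, the system of translates {x ↦ g(x − λ_n) : n > N} is complete in L^p(ℝ). -/
open MeasureTheory ENNReal

/-- A Landau set: `Ω(L, h) = ⋃_{|l| ≤ L} [l - h/2, l + h/2]` with `L` a positive
integer and `0 < h < 1`. -/
def IsLandauSet (Ω : Set ℝ) : Prop :=
  ∃ L : ℕ, 0 < L ∧ ∃ h : ℝ, 0 < h ∧ h < 1 ∧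
    Ω = ⋃ l ∈ Finset.Icc (-(L : ℤ)) (L : ℤ), Set.Icc ((l : ℝ) - h / 2) ((l : ℝ) + h / 2)

/-- A real sequence `(lam n)_{n ≥ 1}` is a Landau system if for every positive integer
`N` and every Landau set `Ω`, the exponential system `{t ↦ e^{2πi lam n t} : n > N}`
has dense linear span in `L²(Ω)`. -/
def IsLandauSystem (lam : ℕ → ℝ) : Prop :=
  ∀ N : ℕ, 0 < N → ∀ Ω : Set ℝ, IsLandauSet Ω →
    Dense (↑(Submodule.span ℂ
        {F : Lp ℂ 2 (volume.restrict Ω) |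
          ∃ n : ℕ, N < n ∧ ⇑F =ᵐ[volume.restrict Ω]
            fun t : ℝ => Complex.exp (2 * Real.pi * Complex.I * lam n * t)}) :
      Set (Lp ℂ 2 (volume.restrict Ω)))

/-- The system of translates `{x ↦ g (x - lam n)}_{n > N}` is complete in `L^p(ℝ)`:
its closed linear span is all of (complex-valued) `L^p(ℝ)`. -/
def TranslatesCompleteFrom (g : ℝ → ℝ) (lam : ℕ → ℝ) (N : ℕ) (p : ℝ≥0∞)
    [Fact (1 ≤ p)] : Prop :=
  Dense (↑(Submodule.span ℂ
      {F : Lp ℂ p (volume : Measure ℝ) |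
        ∃ n : ℕ, N < n ∧ ⇑F =ᵐ[volume] fun x => (g (x - lam n) : ℂ)}) :
    Set (Lp ℂ p (volume : Measure ℝ)))

section Aux

open scoped SchwartzMap FourierTransform Topology ContDiff Convolution
open SchwartzMap Filter Set

noncomputable section

namespace LandauProof

/-- Second derivative on Schwartz space. -/
def D2 : 𝓢(ℝ, ℂ) →L[ℂ] 𝓢(ℝ, ℂ) := (derivCLM ℂ ℂ).comp (derivCLM ℂ ℂ)

/-- Embedding in `L¹ × L¹` by a function and its second derivative. -/
def E : 𝓢(ℝ, ℂ) →L[ℂ] (Lp ℂ 1 (volume : Measure ℝ) × Lp ℂ 1 (volume : Measure ℝ)) :=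
  (toLpCLM ℂ ℂ 1 volume).prod ((toLpCLM ℂ ℂ 1 volume).comp D2)

lemma norm_E_le (F : 𝓢(ℝ, ℂ)) : ‖E F‖ ≤ (∫ x, ‖F x‖) + ∫ x, ‖D2 F x‖ := by
  have h1 : ‖E F‖ = max (∫ x, ‖F x‖) (∫ x, ‖D2 F x‖) := by
    rw [← norm_toLp_one, ← norm_toLp_one]; rfl
  rw [h1]
  have : 0 ≤ ∫ x, ‖F x‖ := integral_nonneg fun _ => norm_nonneg _
  have : 0 ≤ ∫ x, ‖D2 F x‖ := integral_nonneg fun _ => norm_nonneg _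
  apply max_le <;> linarith

lemma le_norm_E (F : 𝓢(ℝ, ℂ)) : (∫ x, ‖F x‖) + ∫ x, ‖D2 F x‖ ≤ 2 * ‖E F‖ := by
  have h1 : ‖E F‖ = max (∫ x, ‖F x‖) (∫ x, ‖D2 F x‖) := by
    rw [← norm_toLp_one, ← norm_toLp_one]; rfl
  rw [h1]
  have := le_max_left (∫ x, ‖F x‖) (∫ x, ‖D2 F x‖)
  have := le_max_right (∫ x, ‖F x‖) (∫ x, ‖D2 F x‖)
  linarith

lemma fourier_derivCLM (F : 𝓢(ℝ, ℂ)) (x : ℝ) :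
    𝓕 (derivCLM ℂ ℂ F) x = (2 * Real.pi * Complex.I * x) * 𝓕 F x := by
  have h := Real.fourier_deriv (f := (F : ℝ → ℂ)) F.integrable F.differentiable
    (derivCLM ℂ ℂ F).integrable
  have h2 := congrFun h x
  rw [fourier_coe, fourier_coe]
  simp only [smul_eq_mul] at h2
  exact h2

lemma fourier_D2 (F : 𝓢(ℝ, ℂ)) (x : ℝ) :
    𝓕 (D2 F) x = -(4 * Real.pi ^ 2 * x ^ 2 : ℝ) * 𝓕 F x := by
  change 𝓕 (derivCLM ℂ ℂ (derivCLM ℂ ℂ F)) x = _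
  rw [fourier_derivCLM, fourier_derivCLM]
  push_cast
  ring_nf
  rw [Complex.I_sq]; ring

lemma fourier_pointwise (F : 𝓢(ℝ, ℂ)) (δ : ℝ) (A : ℝ)
    (hA : (∫ x, ‖F x‖) + δ ^ 2 * ∫ x, ‖D2 F x‖ ≤ A) (x : ℝ) :
    ‖𝓕 F x‖ ≤ A * (1 + (δ * x) ^ 2)⁻¹ := by
  have h1 : ‖𝓕 F x‖ ≤ ∫ x, ‖F x‖ := by
    rw [← norm_toLp_one]; exact norm_fourier_apply_le_toLp_one F x
  have h2 : ‖𝓕 (D2 F) x‖ ≤ ∫ x, ‖D2 F x‖ := by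
    rw [← norm_toLp_one]; exact norm_fourier_apply_le_toLp_one _ x
  rw [fourier_D2, norm_mul, norm_neg, Complex.norm_real, Real.norm_of_nonneg (by positivity)] at h2
  have h3 : ‖𝓕 F x‖ * (1 + (δ * x) ^ 2) ≤ A := by
    refine le_trans ?_ hA
    have hpi : 1 ≤ 4 * Real.pi ^ 2 := by nlinarith [Real.pi_gt_three]
    have h4 : x ^ 2 * ‖𝓕 F x‖ ≤ 4 * Real.pi ^ 2 * x ^ 2 * ‖𝓕 F x‖ := by
      have : 0 ≤ x ^ 2 * ‖𝓕 F x‖ := by positivity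
      nlinarith
    have h5 : δ ^ 2 * (x ^ 2 * ‖𝓕 F x‖) ≤ δ ^ 2 * ∫ x, ‖D2 F x‖ := by
      gcongr; linarith
    nlinarith
  rw [← div_eq_mul_inv, le_div_iff₀ (by positivity)]
  exact h3

lemma fourier_Lp_bound (F : 𝓢(ℝ, ℂ)) (δ : ℝ) (hδ : 0 < δ) (p : ℝ) (hp : 1 ≤ p) (A : ℝ)
    (hA : (∫ x, ‖F x‖) + δ ^ 2 * ∫ x, ‖D2 F x‖ ≤ A) :
    ‖(𝓕 F).toLp (ENNReal.ofReal p) volume‖ ≤ A * (Real.pi / δ) ^ p⁻¹ := by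
  have hp0 : 0 < p := by linarith
  have hA0 : 0 ≤ A := by
    refine le_trans ?_ hA
    have : 0 ≤ ∫ x, ‖F x‖ := integral_nonneg fun _ => norm_nonneg _
    have : 0 ≤ ∫ x, ‖D2 F x‖ := integral_nonneg fun _ => norm_nonneg _
    positivity
  rw [norm_toLp' (by simpa using hp0) (by simp), ENNReal.toReal_ofReal hp0.le]
  have hInteg : Integrable (fun x : ℝ => (1 + (δ * x) ^ 2)⁻¹) :=
    (integrable_inv_one_add_sq).comp_mul_left' hδ.ne'
  have hval : ∫ x : ℝ, (1 + (δ * x) ^ 2)⁻¹ = Real.pi / δ := by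
    have := Measure.integral_comp_mul_left (fun x : ℝ => (1 + x ^ 2)⁻¹) δ
    rw [this, integral_univ_inv_one_add_sq, abs_of_pos (by positivity), smul_eq_mul]
    ring
  have key : ∫ x, ‖𝓕 F x‖ ^ p ≤ A ^ p * (Real.pi / δ) := by
    rw [← hval, ← integral_const_mul]
    refine integral_mono_of_nonneg (.of_forall fun x => by positivity) (hInteg.const_mul _)
      (.of_forall fun x => ?_)
    have h := fourier_pointwise F δ A hA x
    have hle1 : (1 + (δ * x) ^ 2)⁻¹ ≤ 1 := by
      apply inv_le_one_of_one_le₀; nlinarith [sq_nonneg (δ * x)]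
    have h0 : 0 ≤ (1 + (δ * x) ^ 2)⁻¹ := by positivity
    calc ‖𝓕 F x‖ ^ p ≤ (A * (1 + (δ * x) ^ 2)⁻¹) ^ p := by gcongr
      _ = A ^ p * ((1 + (δ * x) ^ 2)⁻¹) ^ p := Real.mul_rpow hA0 h0
      _ ≤ A ^ p * ((1 + (δ * x) ^ 2)⁻¹) ^ (1 : ℝ) := by
        gcongr ?_ * ?_
        exact Real.rpow_le_rpow_of_exponent_ge (by positivity) hle1 hp
      _ = _ := by rw [Real.rpow_one]
  calc (∫ x, ‖𝓕 F x‖ ^ p) ^ p⁻¹ ≤ (A ^ p * (Real.pi / δ)) ^ p⁻¹ := by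
        gcongr
    _ = A * (Real.pi / δ) ^ p⁻¹ := by
        rw [Real.mul_rpow (by positivity) (by positivity), Real.rpow_rpow_inv hA0 hp0.ne']

lemma fourier_Lp_bound_E (F : 𝓢(ℝ, ℂ)) (p : ℝ) (hp : 1 ≤ p) :
    ‖(𝓕 F).toLp (ENNReal.ofReal p) volume‖ ≤ 8 * ‖E F‖ := by
  have h := fourier_Lp_bound F 1 one_pos p hp (2 * ‖E F‖) (by simpa using le_norm_E F)
  refine h.trans ?_
  have : (Real.pi / 1) ^ p⁻¹ ≤ 4 := by
    rw [div_one]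
    calc Real.pi ^ p⁻¹ ≤ Real.pi ^ (1 : ℝ) := by
          apply Real.rpow_le_rpow_of_exponent_le
          · linarith [Real.pi_gt_three]
          · exact inv_le_one_of_one_le₀ hp
      _ ≤ 4 := by rw [Real.rpow_one]; exact Real.pi_le_four
  nlinarith [norm_nonneg (E F)]

lemma D2_mul (F D : 𝓢(ℝ, ℂ)) (u u1 u2 : ℝ → ℂ) (hu : ∀ x, HasDerivAt u (u1 x) x)
    (hu1 : ∀ x, HasDerivAt u1 (u2 x) x) (hD : ∀ x, D x = u x * F x) (x : ℝ) :
    D2 D x = u2 x * F x + 2 * u1 x * derivCLM ℂ ℂ F x + u x * D2 F x := by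
  have e1 : ∀ x, derivCLM ℂ ℂ D x = u1 x * F x + u x * derivCLM ℂ ℂ F x := by
    intro x
    have : (D : ℝ → ℂ) = fun x => u x * F x := funext hD
    rw [derivCLM_apply, this]
    exact ((hu x).mul (F.hasDerivAt x)).deriv
  have e2 : (derivCLM ℂ ℂ D : ℝ → ℂ) = fun x => u1 x * F x + u x * derivCLM ℂ ℂ F x := funext e1
  change derivCLM ℂ ℂ (derivCLM ℂ ℂ D) x = _
  rw [derivCLM_apply, e2]
  have := ((hu1 x).mul (F.hasDerivAt x)).add ((hu x).mul ((derivCLM ℂ ℂ F).hasDerivAt x))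
  refine this.deriv.trans ?_
  change _ = _ + _ + u x * derivCLM ℂ ℂ (derivCLM ℂ ℂ F) x
  simp only [derivCLM_apply]
  ring


/-- A smooth bump function as a complex Schwartz function. -/
def bmp : 𝓢(ℝ, ℂ) :=
  let η : ContDiffBump (0 : ℝ) := ⟨1 / 2, 1, by norm_num, by norm_num⟩
  HasCompactSupport.toSchwartzMap (f := fun x => ((η x : ℝ) : ℂ))
    (η.hasCompactSupport.comp_left (g := fun y : ℝ => (y : ℂ)) (by simp))
    (Complex.ofRealCLM.contDiff.comp η.contDiff)

lemma bmp_one (x : ℝ) (hx : |x| ≤ 1 / 2) : bmp x = 1 := by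
  let η : ContDiffBump (0 : ℝ) := ⟨1 / 2, 1, by norm_num, by norm_num⟩
  have : η x = 1 := η.one_of_mem_closedBall (by rw [Metric.mem_closedBall, Real.dist_eq, sub_zero]; exact hx)
  change ((η x : ℝ) : ℂ) = 1
  rw [this]; simp

lemma bmp_zero (x : ℝ) (hx : 1 < |x|) : bmp x = 0 := by
  let η : ContDiffBump (0 : ℝ) := ⟨1 / 2, 1, by norm_num, by norm_num⟩
  have : η x = 0 := η.zero_of_le_dist (by simpa using hx.le)
  change ((η x : ℝ) : ℂ) = 0
  rw [this]; simp

lemma bmp_tsupport : tsupport bmp ⊆ Metric.closedBall 0 1 := by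
  apply closure_minimal _ Metric.isClosed_closedBall
  intro x hx
  by_contra h
  apply hx
  apply bmp_zero
  simpa using h

/-- Common bound for the bump and its derivatives. -/
def bC : ℝ := SchwartzMap.seminorm ℝ 0 0 bmp + SchwartzMap.seminorm ℝ 0 0 (derivCLM ℂ ℂ bmp) +
  SchwartzMap.seminorm ℝ 0 0 (D2 bmp)

lemma bnd (F : 𝓢(ℝ, ℂ)) : ∃ C, 0 ≤ C ∧ (∀ x, ‖F x‖ ≤ C) ∧ (∀ x, ‖derivCLM ℂ ℂ F x‖ ≤ C) ∧
    (∀ x, ‖D2 F x‖ ≤ C) := by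
  have h1 := apply_nonneg (SchwartzMap.seminorm ℝ 0 0) F
  have h2 := apply_nonneg (SchwartzMap.seminorm ℝ 0 0) (derivCLM ℂ ℂ F)
  have h3 := apply_nonneg (SchwartzMap.seminorm ℝ 0 0) (D2 F)
  refine ⟨SchwartzMap.seminorm ℝ 0 0 F + SchwartzMap.seminorm ℝ 0 0 (derivCLM ℂ ℂ F) +
    SchwartzMap.seminorm ℝ 0 0 (D2 F), by positivity, fun x => ?_, fun x => ?_, fun x => ?_⟩
  · linarith [norm_le_seminorm ℝ F x]
  · linarith [norm_le_seminorm ℝ (derivCLM ℂ ℂ F) x]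
  · linarith [norm_le_seminorm ℝ (D2 F) x]

lemma scaled_deriv (G : 𝓢(ℝ, ℂ)) (a δ : ℝ) (c : ℂ) (x : ℝ) :
    HasDerivAt (fun x : ℝ => c * G ((x - a) / δ)) (c / δ * derivCLM ℂ ℂ G ((x - a) / δ)) x := by
  have h1 : HasDerivAt (fun x : ℝ => (x - a) / δ) (1 / δ) x :=
    ((hasDerivAt_id x).sub_const a).div_const δ
  have h2 := ((G.hasDerivAt ((x - a) / δ)).scomp x h1).const_mul c
  convert! h2 using 1
  rw [derivCLM_apply, Complex.real_smul]
  push_cast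
  ring

/-- `F` multiplied by a rescaled bump. -/
def cut (F : 𝓢(ℝ, ℂ)) (a δ : ℝ) (hδ : 0 < δ) : 𝓢(ℝ, ℂ) :=
  HasCompactSupport.toSchwartzMap (f := fun x => bmp ((x - a) / δ) * F x)
    (by
      apply HasCompactSupport.mul_right
      apply HasCompactSupport.of_support_subset_isCompact (K := Metric.closedBall a δ)
        (isCompact_closedBall a δ)
      intro x hx
      by_contra h
      apply hx
      apply bmp_zero
      rw [abs_div, abs_of_pos hδ, lt_div_iff₀ hδ]
      simpa [Real.dist_eq] using h)
    (by
      apply ContDiff.mul _ (F.smooth ⊤)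
      exact (bmp.smooth ⊤).comp (by fun_prop))

lemma cut_apply (F : 𝓢(ℝ, ℂ)) (a δ : ℝ) (hδ : 0 < δ) (x : ℝ) :
    cut F a δ hδ x = bmp ((x - a) / δ) * F x := rfl

lemma D2_cut (F : 𝓢(ℝ, ℂ)) (a δ : ℝ) (hδ : 0 < δ) (x : ℝ) :
    D2 (cut F a δ hδ) x = 1 / δ / δ * D2 bmp ((x - a) / δ) * F x +
      2 * (1 / δ * derivCLM ℂ ℂ bmp ((x - a) / δ)) * derivCLM ℂ ℂ F x +
        bmp ((x - a) / δ) * D2 F x := by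
  refine D2_mul F (cut F a δ hδ) (fun x => bmp ((x - a) / δ))
    (fun x => 1 / δ * derivCLM ℂ ℂ bmp ((x - a) / δ))
    (fun x => 1 / δ / δ * D2 bmp ((x - a) / δ)) (fun x => ?_) (fun x => ?_) (fun x => rfl) x
  · simpa using scaled_deriv bmp a δ 1 x
  · exact scaled_deriv (derivCLM ℂ ℂ bmp) a δ (1 / δ) x

lemma cut_zero (F : 𝓢(ℝ, ℂ)) (a δ : ℝ) (hδ : 0 < δ) :
    tsupport (cut F a δ hδ) ⊆ Metric.closedBall a δ := by
  apply closure_minimal _ Metric.isClosed_closedBall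
  intro x hx
  by_contra h
  apply hx
  rw [cut_apply, bmp_zero, zero_mul]
  rw [abs_div, abs_of_pos hδ, lt_div_iff₀ hδ]
  simpa [Real.dist_eq] using h

lemma int_ball_bound (G : 𝓢(ℝ, ℂ)) (a δ C : ℝ) (hδ : 0 < δ)
    (hG : tsupport G ⊆ Metric.closedBall a δ) (hC : ∀ x, ‖G x‖ ≤ C) :
    ∫ x, ‖G x‖ ≤ C * (2 * δ) := by
  have h0 : ∀ x, x ∉ Metric.closedBall a δ → ‖G x‖ = 0 := by
    intro x hx
    rw [norm_eq_zero]
    by_contra h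
    exact hx (hG (subset_tsupport _ h))
  rw [← setIntegral_eq_integral_of_forall_compl_eq_zero h0]
  have := norm_setIntegral_le_of_norm_le_const (μ := volume) (s := Metric.closedBall a δ)
    (f := fun x => ‖G x‖) (C := C) measure_closedBall_lt_top (fun x _ => by simpa using hC x)
  refine (Real.le_norm_self _).trans (this.trans (le_of_eq ?_))
  rw [measureReal_def, Real.volume_closedBall, ENNReal.toReal_ofReal (by positivity)]

lemma remove_point (F : 𝓢(ℝ, ℂ)) (a : ℝ) (p : ℝ) (hp : 1 < p) (ε : ℝ) (hε : 0 < ε) :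
    ∃ F' : 𝓢(ℝ, ℂ), ‖(𝓕 (F - F')).toLp (ENNReal.ofReal p) volume‖ ≤ ε ∧
      a ∉ tsupport F' ∧ tsupport F' ⊆ tsupport F := by
  obtain ⟨C, hC, hF0, hF1, hF2⟩ := bnd F
  obtain ⟨B, hB, hb0, hb1, hb2⟩ := bnd bmp
  have hlim : Tendsto (fun δ : ℝ => 10 * (B * C) * Real.pi ^ p⁻¹ * δ ^ (1 - p⁻¹)) (𝓝[>] 0) (𝓝 0) := by
    have h1 : 0 < 1 - p⁻¹ := by
      have := inv_lt_one_of_one_lt₀ hp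
      linarith
    have h2 : Tendsto (fun δ : ℝ => δ ^ (1 - p⁻¹)) (𝓝[>] 0) (𝓝 0) := by
      have := (Real.continuousAt_rpow_const 0 (1 - p⁻¹) (Or.inr h1.le)).tendsto
      rw [Real.zero_rpow h1.ne'] at this
      exact this.mono_left nhdsWithin_le_nhds
    simpa using h2.const_mul (10 * (B * C) * Real.pi ^ p⁻¹)
  have hev := (hlim.eventually (ge_mem_nhds hε)).and
    (Ioo_mem_nhdsGT (show (0 : ℝ) < 1 by norm_num))
  obtain ⟨δ, hδε, hδ, hδ1⟩ := hev.exists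
  refine ⟨F - cut F a δ hδ, ?_, ?_, ?_⟩
  · have hsub : F - (F - cut F a δ hδ) = cut F a δ hδ := by ext x; simp
    rw [hsub]
    have hz := cut_zero F a δ hδ
    have hz2 : tsupport (D2 (cut F a δ hδ)) ⊆ Metric.closedBall a δ :=
      ((tsupport_derivCLM_subset ℂ _).trans (tsupport_derivCLM_subset ℂ _)).trans hz
    have i1 : ∫ x, ‖cut F a δ hδ x‖ ≤ (B * C) * (2 * δ) := by
      apply int_ball_bound _ a δ _ hδ hz
      intro x
      rw [cut_apply, norm_mul]
      exact mul_le_mul (hb0 _) (hF0 _) (norm_nonneg _) hB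
    have i2 : ∫ x, ‖D2 (cut F a δ hδ) x‖ ≤ (4 * (B * C) / δ ^ 2) * (2 * δ) := by
      apply int_ball_bound _ a δ _ hδ hz2
      intro x
      rw [D2_cut]
      have n1 : ‖(1 / δ / δ : ℂ) * D2 bmp ((x - a) / δ) * F x‖ ≤ 1 / δ ^ 2 * (B * C) := by
        rw [norm_mul, norm_mul, mul_assoc]
        have : ‖(1 / δ / δ : ℂ)‖ = 1 / δ ^ 2 := by
          rw [norm_div, norm_div, Complex.norm_real, Real.norm_of_nonneg hδ.le]
          simp; field_simp
        rw [this]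
        gcongr
        · exact hb2 _
        · exact hF0 _
      have n2 : ‖2 * ((1 / δ : ℂ) * derivCLM ℂ ℂ bmp ((x - a) / δ)) * derivCLM ℂ ℂ F x‖ ≤
          2 * (1 / δ * (B * C)) := by
        rw [norm_mul, norm_mul, norm_mul, mul_assoc, mul_assoc]
        have : ‖(1 / δ : ℂ)‖ = 1 / δ := by
          rw [norm_div, Complex.norm_real, Real.norm_of_nonneg hδ.le]; simp
        rw [this]
        simp only [Complex.norm_ofNat]
        gcongr
        · exact hb1 _
        · exact hF1 _
      have n3 : ‖bmp ((x - a) / δ) * D2 F x‖ ≤ B * C := by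
        rw [norm_mul]
        exact mul_le_mul (hb0 _) (hF2 _) (norm_nonneg _) hB
      have hd : 1 / δ ≤ 1 / δ ^ 2 := by
        apply one_div_le_one_div_of_le (by positivity); nlinarith
      have hd2 : 1 ≤ 1 / δ ^ 2 := by
        rw [le_div_iff₀ (by positivity)]; nlinarith
      have hBC : 0 ≤ B * C := by positivity
      calc _ ≤ 1 / δ ^ 2 * (B * C) + 2 * (1 / δ * (B * C)) + B * C :=
            (norm_add₃_le).trans (by linarith)
        _ ≤ 1 / δ ^ 2 * (B * C) + 2 * (1 / δ ^ 2 * (B * C)) + 1 / δ ^ 2 * (B * C) := by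
            have k1 := mul_le_mul_of_nonneg_right hd hBC
            have k2 := mul_le_mul_of_nonneg_right hd2 hBC
            linarith
        _ = _ := by ring
    have hA : (∫ x, ‖cut F a δ hδ x‖) + δ ^ 2 * ∫ x, ‖D2 (cut F a δ hδ) x‖ ≤ 10 * (B * C) * δ := by
      have : δ ^ 2 * ∫ x, ‖D2 (cut F a δ hδ) x‖ ≤ δ ^ 2 * ((4 * (B * C) / δ ^ 2) * (2 * δ)) := by
        gcongr
      have e : δ ^ 2 * ((4 * (B * C) / δ ^ 2) * (2 * δ)) = 8 * (B * C) * δ := by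
        field_simp; ring
      linarith
    refine (fourier_Lp_bound _ δ hδ p hp.le _ hA).trans (le_trans (le_of_eq ?_) hδε)
    rw [Real.div_rpow Real.pi_pos.le hδ.le, Real.rpow_sub hδ, Real.rpow_one]
    ring
  · rw [notMem_tsupport_iff_eventuallyEq]
    filter_upwards [Metric.ball_mem_nhds a (half_pos hδ)] with x hx
    simp only [sub_apply, cut_apply, Pi.zero_apply]
    rw [bmp_one, one_mul, sub_self]
    rw [abs_div, abs_of_pos hδ, div_le_iff₀ hδ]
    rw [Metric.mem_ball, Real.dist_eq] at hx
    linarith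
  · apply closure_mono
    intro x hx h
    apply hx
    have h' : F x = 0 := h
    simp [cut_apply, h']

lemma remove_points (F : 𝓢(ℝ, ℂ)) (s : Finset ℝ) (p : ℝ) (hp : 1 < p) (ε : ℝ) (hε : 0 < ε) :
    ∃ F' : 𝓢(ℝ, ℂ), ‖(𝓕 (F - F')).toLp (ENNReal.ofReal p) volume‖ ≤ ε ∧
      (∀ a ∈ s, a ∉ tsupport F') ∧ tsupport F' ⊆ tsupport F := by
  induction s using Finset.induction_on generalizing ε with
  | empty => 
    refine ⟨F, ?_, by simp, subset_rfl⟩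
    have := fourier_Lp_bound_E (F - F) p hp.le
    rw [sub_self] at this ⊢
    rw [map_zero, norm_zero, mul_zero] at this
    linarith
  | insert a s ha ih => 
    obtain ⟨F1, h1, h2, h3⟩ := ih (ε / 2) (half_pos hε)
    obtain ⟨F2, g1, g2, g3⟩ := remove_point F1 a p hp (ε / 2) (half_pos hε)
    refine ⟨F2, ?_, ?_, g3.trans h3⟩
    · have e : (𝓕 (F - F2)).toLp (ENNReal.ofReal p) volume =
        (𝓕 (F - F1)).toLp (ENNReal.ofReal p) volume +
          (𝓕 (F1 - F2)).toLp (ENNReal.ofReal p) volume := by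
        have : F - F2 = (F - F1) + (F1 - F2) := by abel
        rw [this, FourierTransform.fourier_add]
        rfl
      rw [e]
      have : Fact (1 ≤ ENNReal.ofReal p) := ⟨ENNReal.one_le_ofReal.mpr hp.le⟩
      exact (norm_add_le _ _).trans (by linarith)
    · intro b hb
      rcases Finset.mem_insert.1 hb with rfl | hb
      · exact g2
      · exact fun h => h2 b hb (g3 h)

lemma cutoff_lim (G : 𝓢(ℝ, ℂ)) :
    Tendsto (fun n : ℕ => ∫ x, ‖(1 - bmp ((x - 0) / (n + 1 : ℝ))) * G x‖) atTop (𝓝 0) := by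
  obtain ⟨B, hB, hb0, -, -⟩ := bnd bmp
  suffices h : Tendsto (fun n : ℕ => ∫ x, ‖(1 - bmp ((x - 0) / (n + 1 : ℝ))) * G x‖) atTop
      (𝓝 (∫ x : ℝ, (0 : ℝ))) by simpa only [integral_zero] using h
  refine tendsto_integral_of_dominated_convergence (fun x => (1 + B) * ‖G x‖) (fun n => ?_)
    (G.integrable.norm.const_mul _) (fun n => .of_forall fun x => ?_) (.of_forall fun x => ?_)
  · apply Continuous.aestronglyMeasurable
    have := bmp.continuous
    have := G.continuous
    fun_prop
  · rw [norm_norm, norm_mul]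
    gcongr
    refine (norm_sub_le _ _).trans ?_
    simpa using hb0 _
  · apply tendsto_const_nhds.congr'
    obtain ⟨n0, hn0⟩ := exists_nat_gt (2 * |x|)
    filter_upwards [eventually_ge_atTop n0] with n hn
    rw [bmp_one]
    · simp
    · have : (n0 : ℝ) ≤ n := by exact_mod_cast hn
      rw [sub_zero, abs_div, abs_of_pos (show (0 : ℝ) < n + 1 by positivity),
        div_le_iff₀ (by positivity)]
      linarith

lemma compact_approx (F : 𝓢(ℝ, ℂ)) (ε : ℝ) (hε : 0 < ε) :
    ∃ F' : 𝓢(ℝ, ℂ), ‖E (F - F')‖ ≤ ε ∧ HasCompactSupport F' := by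
  obtain ⟨B, hB, hb0, hb1, hb2⟩ := bnd bmp
  have hpos : ∀ n : ℕ, (0 : ℝ) < n + 1 := fun n => by positivity
  have hinv : Tendsto (fun n : ℕ => 1 / ((n : ℝ) + 1)) atTop (𝓝 0) :=
    tendsto_one_div_add_atTop_nhds_zero_nat
  have hlim : Tendsto (fun n : ℕ => (∫ x, ‖(1 - bmp ((x - 0) / (n + 1 : ℝ))) * F x‖) +
      ((1 / ((n : ℝ) + 1)) * (1 / ((n : ℝ) + 1)) * (B * ∫ x, ‖F x‖) +
        (1 / ((n : ℝ) + 1)) * (2 * B * ∫ x, ‖derivCLM ℂ ℂ F x‖) +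
        ∫ x, ‖(1 - bmp ((x - 0) / (n + 1 : ℝ))) * D2 F x‖)) atTop (𝓝 0) := by
    have := (cutoff_lim F).add ((((hinv.mul hinv).mul_const (B * ∫ x, ‖F x‖)).add
      (hinv.mul_const (2 * B * ∫ x, ‖derivCLM ℂ ℂ F x‖))).add (cutoff_lim (D2 F)))
    simpa using this
  obtain ⟨n, hn⟩ := (hlim.eventually (ge_mem_nhds hε)).exists
  refine ⟨cut F 0 (n + 1) (hpos n), ?_, ?_⟩
  · refine (norm_E_le _).trans (le_trans ?_ hn)
    have hcont : Continuous fun x : ℝ => (1 - bmp ((x - 0) / (n + 1 : ℝ))) := by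
      have := bmp.continuous
      fun_prop
    have hI : Integrable (fun x => ‖(1 - bmp ((x - 0) / (n + 1 : ℝ))) * D2 F x‖) := by
      apply Integrable.norm
      refine (D2 F).integrable.bdd_mul (c := 1 + B) hcont.aestronglyMeasurable
        (.of_forall fun x => ?_)
      refine (norm_sub_le _ _).trans ?_
      simpa using hb0 _
    gcongr ?_ + ?_
    · apply le_of_eq
      congr 1
      ext x
      simp only [sub_apply, cut_apply]
      congr 1
      ring
    · have hF : Integrable (fun x => (1 / ((n : ℝ) + 1)) * (1 / ((n : ℝ) + 1)) * (B * ‖F x‖)) :=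
        (F.integrable.norm.const_mul _).const_mul _
      have hF' : Integrable (fun x => (1 / ((n : ℝ) + 1)) * (2 * B * ‖derivCLM ℂ ℂ F x‖)) :=
        ((derivCLM ℂ ℂ F).integrable.norm.const_mul _).const_mul _
      rw [← integral_const_mul B, ← integral_const_mul, ← integral_const_mul (2 * B),
        ← integral_const_mul, ← integral_add hF hF', ← integral_add (by exact hF.add hF') hI]
      refine integral_mono (D2 _).integrable.norm ((hF.add hF').add hI) fun x => ?_
      rw [map_sub, sub_apply, D2_cut]
      have e : D2 F x - (1 / (↑(n + 1 : ℝ) : ℂ) / (↑(n + 1 : ℝ) : ℂ) *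
          D2 bmp ((x - 0) / (n + 1)) * F x +
          2 * (1 / (↑(n + 1 : ℝ) : ℂ) * derivCLM ℂ ℂ bmp ((x - 0) / (n + 1))) * derivCLM ℂ ℂ F x +
          bmp ((x - 0) / (n + 1)) * D2 F x) =
          -(((1 / (n + 1) * (1 / (n + 1)) : ℝ) : ℂ) * (D2 bmp ((x - 0) / (n + 1)) * F x)) +
          -(((1 / (n + 1) : ℝ) : ℂ) * (2 * derivCLM ℂ ℂ bmp ((x - 0) / (n + 1)) *
            derivCLM ℂ ℂ F x)) + (1 - bmp ((x - 0) / (n + 1))) * D2 F x := by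
        push_cast
        ring
      rw [e]
      refine (norm_add₃_le).trans ?_
      rw [norm_neg, norm_neg, norm_mul, norm_mul (Complex.ofReal _), Complex.norm_real,
        Complex.norm_real, Real.norm_of_nonneg (by positivity), Real.norm_of_nonneg (by positivity),
        norm_mul, norm_mul, norm_mul (2 : ℂ), Complex.norm_ofNat]
      gcongr
      · exact hb2 _
      · exact hb1 _
  · exact HasCompactSupport.of_support_subset_isCompact (isCompact_closedBall 0 (n + 1 : ℝ))
      ((subset_tsupport _).trans (cut_zero F 0 (n + 1) (hpos n)))


/-- Widths of the Landau sets. -/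
def hk (k : ℕ) : ℝ := 1 - 1 / ((k : ℝ) + 2)

lemma hk_pos (k : ℕ) : 0 < hk k := by
  unfold hk
  rw [sub_pos, div_lt_one (by positivity)]
  have : (0 : ℝ) ≤ k := by positivity
  linarith

lemma hk_lt (k : ℕ) : hk k < 1 := by
  unfold hk
  have : 0 < 1 / ((k : ℝ) + 2) := by positivity
  linarith

lemma hk_mono : Monotone hk := by
  intro a b hab
  unfold hk
  have : (a : ℝ) ≤ b := by exact_mod_cast hab
  gcongr

lemma hk_lim : Tendsto hk atTop (𝓝 1) := by
  unfold hk
  have h1 : Tendsto (fun k : ℕ => 1 / ((k : ℝ) + 2)) atTop (𝓝 0) := by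
    simp only [one_div]
    apply Tendsto.inv_tendsto_atTop
    exact tendsto_atTop_add_const_right _ _ tendsto_natCast_atTop_atTop
  simpa using h1.const_sub 1

/-- Open Landau sets. -/
def O (k : ℕ) : Set ℝ := {t | ∃ l : ℤ, |l| ≤ (k : ℤ) ∧ |t - l| < hk k / 2}

lemma O_open (k : ℕ) : IsOpen (O k) := by
  have : O k = ⋃ l : ℤ, ⋃ _ : |l| ≤ (k : ℤ), {t : ℝ | |t - l| < hk k / 2} := by
    ext t; simp [O]
  rw [this]
  refine isOpen_iUnion fun l => isOpen_iUnion fun _ => ?_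
  exact isOpen_lt (by fun_prop) continuous_const

lemma O_mono : Monotone O := by
  intro a b hab t ht
  obtain ⟨l, hl, h⟩ := ht
  refine ⟨l, hl.trans (by exact_mod_cast hab), h.trans_le ?_⟩
  have := hk_mono hab
  linarith

lemma O_cover (t : ℝ) (ht : ∀ l : ℤ, t ≠ l + 1 / 2) : ∃ k, t ∈ O k := by
  have h1 : |t - round t| < 1 / 2 := by
    refine lt_of_le_of_ne (abs_sub_round t) fun h => ?_
    rcases abs_eq (by norm_num) |>.1 h with h | h
    · exact ht (round t) (by linarith)
    · exact ht (round t - 1) (by push_cast; linarith)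
  have h2 : ∀ᶠ k in atTop, 2 * |t - round t| < hk k := hk_lim.eventually (lt_mem_nhds (by linarith))
  obtain ⟨k, hk1, hk2⟩ := (h2.and (eventually_ge_atTop (round t).natAbs)).exists
  refine ⟨k, round t, ?_, by linarith⟩
  rw [Int.abs_eq_natAbs]
  exact_mod_cast hk2

lemma O_compact (K : Set ℝ) (hK : IsCompact K) (h : ∀ l : ℤ, ((l : ℝ) + 1 / 2) ∉ K) :
    ∃ k, K ⊆ O k := by
  refine hK.elim_directed_cover O O_open (fun t ht => ?_) (O_mono.directed_le)
  rw [mem_iUnion]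
  exact O_cover t fun l e => h l (e ▸ ht)

/-- Target functions. -/
def Tg (k : ℕ) : Set 𝓢(ℝ, ℂ) := {F | HasCompactSupport F ∧ tsupport F ⊆ O k}

lemma target_dense (p : ℝ) (hp : 1 < p) (f : Lp ℂ (ENNReal.ofReal p) (volume : Measure ℝ))
    (ε : ℝ) (hε : 0 < ε) :
    ∃ k, ∃ F ∈ Tg k, ‖f - (𝓕 F).toLp (ENNReal.ofReal p) volume‖ ≤ ε := by
  have : Fact (1 ≤ ENNReal.ofReal p) := ⟨ENNReal.one_le_ofReal.mpr hp.le⟩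
  have hd := denseRange_toLpCLM (E := ℝ) (F := ℂ) (p := ENNReal.ofReal p) (by simp)
    (μ := (volume : Measure ℝ))
  obtain ⟨φ, hφ⟩ := Metric.denseRange_iff.1 hd f (ε / 3) (by positivity)
  obtain ⟨F1, h1, h2⟩ := compact_approx (𝓕⁻ φ) (ε / 24) (by positivity)
  obtain ⟨M, hM⟩ : ∃ M : ℕ, tsupport F1 ⊆ Metric.closedBall 0 M := by
    obtain ⟨r, hr⟩ := h2.isCompact.isBounded.subset_closedBall 0
    obtain ⟨M, hM⟩ := exists_nat_ge r
    exact ⟨M, hr.trans (Metric.closedBall_subset_closedBall hM)⟩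
  obtain ⟨F2, g1, g2, g3⟩ := remove_points F1
    ((Finset.Icc (-(M : ℤ) - 1) M).image fun l : ℤ => (l : ℝ) + 1 / 2) p hp (ε / 3) (by positivity)
  have hc : HasCompactSupport F2 := h2.isCompact.of_isClosed_subset (isClosed_tsupport _) g3
  obtain ⟨k, hk⟩ := O_compact (tsupport F2) hc.isCompact (by
    intro l hl
    have hl' := hM (g3 hl)
    rw [Metric.mem_closedBall, Real.dist_eq, sub_zero, abs_le] at hl'
    refine g2 _ (Finset.mem_image.2 ⟨l, Finset.mem_Icc.2 ⟨?_, ?_⟩, rfl⟩) hl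
    · have : ((-(M : ℤ) - 1 : ℤ) : ℝ) ≤ l := by push_cast; linarith
      exact_mod_cast this
    · have : (l : ℝ) ≤ ((M : ℤ) : ℝ) := by push_cast; linarith
      exact_mod_cast this)
  refine ⟨k, F2, ⟨hc, hk⟩, ?_⟩
  have e : f - (𝓕 F2).toLp (ENNReal.ofReal p) volume =
      (f - φ.toLp (ENNReal.ofReal p) volume) +
        (𝓕 (𝓕⁻ φ - F1)).toLp (ENNReal.ofReal p) volume +
        (𝓕 (F1 - F2)).toLp (ENNReal.ofReal p) volume := by
    have e1 : ∀ a b : 𝓢(ℝ, ℂ), (𝓕 (a - b)).toLp (ENNReal.ofReal p) volume =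
        (𝓕 a).toLp (ENNReal.ofReal p) volume - (𝓕 b).toLp (ENNReal.ofReal p) volume := by
      intro a b
      rw [← fourierTransformCLM_apply (𝕜 := ℂ), map_sub]
      rfl
    rw [e1, e1, FourierTransform.fourier_fourierInv_eq]
    abel
  rw [e]
  rw [dist_eq_norm] at hφ
  have b1 := fourier_Lp_bound_E (𝓕⁻ φ - F1) p hp.le
  have b2 : ‖f - φ.toLp (ENNReal.ofReal p) volume‖ ≤ ε / 3 := hφ.le
  refine norm_add₃_le.trans ?_
  linarith


/-- The exponentials. -/
def ex (a : ℝ) (t : ℝ) : ℂ := Complex.exp (2 * Real.pi * Complex.I * a * t)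

lemma ex_continuous (a : ℝ) : Continuous (ex a) := by unfold ex; fun_prop

lemma ex_add (a s t : ℝ) : ex a (s + t) = ex a s * ex a t := by
  unfold ex; rw [← Complex.exp_add]; congr 1; push_cast; ring

/-- Landau sets. -/
def Om (L : ℕ) (h : ℝ) : Set ℝ :=
  ⋃ l ∈ Finset.Icc (-(L : ℤ)) (L : ℤ), Set.Icc ((l : ℝ) - h / 2) ((l : ℝ) + h / 2)

lemma mem_Om {L : ℕ} {h t : ℝ} : t ∈ Om L h ↔ ∃ l : ℤ, |l| ≤ (L : ℤ) ∧ |t - l| ≤ h / 2 := by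
  simp only [Om, Set.mem_iUnion, Finset.mem_Icc, Set.mem_Icc, abs_le]
  constructor
  · rintro ⟨l, h1, h2⟩; exact ⟨l, h1, by constructor <;> linarith⟩
  · rintro ⟨l, h1, h2⟩; exact ⟨l, h1, by constructor <;> linarith⟩

lemma Om_compact (L : ℕ) (h : ℝ) : IsCompact (Om L h) :=
  Finset.isCompact_biUnion _ fun _ _ => isCompact_Icc

lemma span_rep (lam : ℕ → ℝ) (N : ℕ) (μ : Measure ℝ) (x : Lp ℂ 2 μ)
    (hx : x ∈ Submodule.span ℂ {F : Lp ℂ 2 μ |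
          ∃ n : ℕ, N < n ∧ ⇑F =ᵐ[μ]
            fun t : ℝ => Complex.exp (2 * Real.pi * Complex.I * lam n * t)}) :
    ∃ c : ℕ →₀ ℂ, (∀ n ∈ c.support, N < n) ∧
      ⇑x =ᵐ[μ] fun t => c.sum fun n a => a * ex (lam n) t := by
  induction hx using Submodule.span_induction with
  | mem x h =>
    obtain ⟨n, hn, h⟩ := h
    refine ⟨Finsupp.single n 1, ?_, ?_⟩
    · intro m hm
      have := Finsupp.support_single_subset hm
      simp at this; omega
    · filter_upwards [h] with t ht
      rw [ht]; simp [ex]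
  | zero =>
    refine ⟨0, by simp, ?_⟩
    filter_upwards [Lp.coeFn_zero ℂ 2 μ] with t ht
    rw [ht]; simp
  | add x y _ _ hx hy =>
    obtain ⟨c, hc, hx⟩ := hx
    obtain ⟨d, hd, hy⟩ := hy
    refine ⟨c + d, ?_, ?_⟩
    · intro n hn
      rcases Finset.mem_union.1 (Finsupp.support_add hn) with h | h
      exacts [hc n h, hd n h]
    · filter_upwards [Lp.coeFn_add x y, hx, hy] with t ht h1 h2
      rw [ht, Pi.add_apply, h1, h2, Finsupp.sum_add_index' (by simp) (by intros; ring)]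
  | smul a x _ hx =>
    obtain ⟨c, hc, hx⟩ := hx
    refine ⟨a • c, fun n hn => hc n (Finsupp.support_smul hn), ?_⟩
    filter_upwards [Lp.coeFn_smul a x, hx] with t ht h1
    rw [ht, Pi.smul_apply, h1, Finsupp.sum_smul_index' (by simp), Finsupp.smul_sum]
    simp [mul_assoc]

/-- Exponential polynomial. -/
def ep (lam : ℕ → ℝ) (c : ℕ →₀ ℂ) (t : ℝ) : ℂ := c.sum fun n a => a * ex (lam n) t

lemma ep_continuous (lam : ℕ → ℝ) (c : ℕ →₀ ℂ) : Continuous (ep lam c) := by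
  unfold ep Finsupp.sum
  exact continuous_finsetSum _ fun n _ => continuous_const.mul (ex_continuous _)

lemma density_L1 (lam : ℕ → ℝ) (hlam : IsLandauSystem lam) (N : ℕ) (hN : 0 < N) (L : ℕ)
    (hL : 0 < L) (h : ℝ) (h0 : 0 < h) (h1 : h < 1) (H : 𝓢(ℝ, ℂ)) (η : ℝ) (hη : 0 < η) :
    ∃ c : ℕ →₀ ℂ, (∀ n ∈ c.support, N < n) ∧
      ∫ t in Om L h, ‖ep lam c t - H t‖ ≤ η := by
  set μ := volume.restrict (Om L h) with hμ
  have : IsFiniteMeasure μ := ⟨by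
    rw [hμ, Measure.restrict_apply_univ]; exact (Om_compact L h).measure_lt_top⟩
  have hH : MemLp H 2 μ := (H.memLp 2 volume).restrict _
  obtain ⟨C, hC0, hC⟩ : ∃ C : ℝ, 0 < C ∧ ∀ f : ℝ → ℂ, MemLp f 2 μ →
      ∫ t, ‖f t‖ ∂μ ≤ C * (eLpNorm f 2 μ).toReal := by
    refine ⟨(μ univ ^ (1/2 : ℝ)).toReal + 1, by positivity, fun f hf => ?_⟩
    have h1 := eLpNorm_le_eLpNorm_mul_rpow_measure_univ (p := 1) (q := 2) (by norm_num) hf.1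
    have hfi : Integrable f μ := hf.integrable (by norm_num)
    have h2 : ∫ t, ‖f t‖ ∂μ = (eLpNorm f 1 μ).toReal := by
      rw [eLpNorm_one_eq_lintegral_enorm, integral_norm_eq_lintegral_enorm hf.1]
    rw [h2]
    have h3 := ENNReal.toReal_mono (by
      apply ENNReal.mul_ne_top hf.2.ne
      apply ENNReal.rpow_ne_top_of_nonneg (by norm_num) (measure_ne_top _ _)) h1
    rw [ENNReal.toReal_mul] at h3
    norm_num at h3 ⊢
    nlinarith [ENNReal.toReal_nonneg (a := eLpNorm f 2 μ)]
  have hd := hlam N hN (Om L h) ⟨L, hL, h, h0, h1, rfl⟩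
  obtain ⟨x, hx, hxd⟩ := Metric.dense_iff.1 hd (hH.toLp H) (η / C) (by positivity)
  obtain ⟨c, hc, hcx⟩ := span_rep lam N μ x hxd
  refine ⟨c, hc, ?_⟩
  have hxe : (fun t => ep lam c t - H t) =ᵐ[μ] ⇑(x - hH.toLp H) := by
    filter_upwards [hcx, hH.coeFn_toLp, Lp.coeFn_sub x (hH.toLp H)] with t h1 h2 h3
    rw [h3, Pi.sub_apply, h1, h2]; rfl
  have hm : MemLp (fun t => ep lam c t - H t) 2 μ := (memLp_congr_ae hxe).2 (Lp.memLp _)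
  refine (hC _ hm).trans ?_
  rw [eLpNorm_congr_ae hxe]
  have : (eLpNorm (⇑(x - hH.toLp H)) 2 μ).toReal = dist x (hH.toLp H) := by
    rw [dist_eq_norm, Lp.norm_def]
  rw [this]
  rw [Metric.mem_ball] at hx
  have := (lt_div_iff₀ hC0).1 hx
  linarith

/-- Convolution of a compactly supported continuous function with an exponential polynomial. -/
lemma conv_ep (lam : ℕ → ℝ) (c : ℕ →₀ ℂ) (ψ : ℝ → ℝ) (hψ : Continuous ψ)
    (hψc : HasCompactSupport ψ) (x : ℝ) :
    (ψ ⋆[ContinuousLinearMap.lsmul ℝ ℝ, volume] (ep lam c)) x =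
      ∑ n ∈ c.support, (c n * ∫ t, ψ t * ex (lam n) (-t)) * ex (lam n) x := by
  unfold MeasureTheory.convolution ep Finsupp.sum
  simp only [ContinuousLinearMap.lsmul_apply, Finset.smul_sum]
  rw [integral_finsetSum]
  · refine Finset.sum_congr rfl fun n _ => ?_
    rw [mul_assoc, ← integral_mul_const, ← integral_const_mul]
    refine integral_congr_ae (ae_of_all _ fun t => ?_)
    simp only [Complex.real_smul, sub_eq_add_neg, ex_add]
    ring
  · intro n _
    have : Continuous fun a => ψ a • (c n * ex (lam n) (x - a)) :=
      hψ.smul (continuous_const.mul ((ex_continuous _).comp (by fun_prop)))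
    exact this.integrable_of_hasCompactSupport hψc.smul_right

lemma lip (F : 𝓢(ℝ, ℂ)) : ∃ C : ℝ, 0 ≤ C ∧ ∀ x y, dist (F x) (F y) ≤ C * dist x y := by
  obtain ⟨C, hC, _, h2, _⟩ := bnd F
  refine ⟨C, hC, fun x y => ?_⟩
  have h := Convex.norm_image_sub_le_of_norm_hasDerivWithin_le (f := F) (f' := fun x => derivCLM ℂ ℂ F x)
    (s := univ) (x := y) (y := x) (C := C) (fun z _ => ?_) (fun z _ => h2 z) convex_univ trivial trivial
  · rw [dist_eq_norm, dist_eq_norm]; exact h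
  · rw [hasDerivWithinAt_univ, derivCLM_apply]
    exact F.differentiableAt.hasDerivAt

lemma conv_bound (L : ℕ) (h δ : ℝ) (hδ : 0 < δ) (ψ : ℝ → ℝ) (hψ : Continuous ψ)
    (hs : ∀ t, δ < |t| → ψ t = 0) (C : ℝ) (hC : ∀ t, |ψ t| ≤ C) (R : ℝ → ℂ) (hR : Continuous R)
    (x : ℝ) (hx : x ∈ Om L h) :
    ‖(ψ ⋆[ContinuousLinearMap.lsmul ℝ ℝ, volume] R) x‖ ≤
      C * ∫ t in Om L (h + 2 * δ), ‖R t‖ := by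
  have hC0 : 0 ≤ C := (abs_nonneg _).trans (hC 0)
  rw [convolution_lsmul_swap]
  refine (norm_integral_le_integral_norm _).trans ?_
  rw [← integral_const_mul, ← integral_indicator (Om_compact _ _).measurableSet]
  have hcs : HasCompactSupport fun t => ‖ψ (x - t) • R t‖ := by
    apply HasCompactSupport.intro (isCompact_Icc (a := x - δ) (b := x + δ))
    intro t ht
    rw [hs (x - t) ?_]
    · simp
    · by_contra hcon
      rw [not_lt, abs_le] at hcon
      exact ht ⟨by linarith, by linarith⟩
  apply integral_mono
  · apply Continuous.integrable_of_hasCompactSupport _ hcs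
    exact ((hψ.comp (by fun_prop)).smul hR).norm
  · rw [integrable_indicator_iff (Om_compact _ _).measurableSet]
    exact ((continuous_const.mul hR.norm).continuousOn).integrableOn_compact (Om_compact _ _)
  · intro t
    by_cases ht : t ∈ Om L (h + 2 * δ)
    · rw [indicator_of_mem ht]
      simp only [norm_smul, Real.norm_eq_abs]
      gcongr
      exact hC _
    · rw [indicator_of_notMem ht]
      beta_reduce
      rw [hs (x - t) ?_]
      · simp
      · by_contra hcon
        rw [not_lt] at hcon
        obtain ⟨l, hl, hxl⟩ := mem_Om.1 hx
        refine ht (mem_Om.2 ⟨l, hl, ?_⟩)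
        have : t - l = -(x - t) + (x - l) := by ring
        rw [this]
        refine (abs_add_le _ _).trans ?_
        rw [abs_neg]; linarith

lemma ex_hasDerivAt (a t : ℝ) : HasDerivAt (ex a) (2 * Real.pi * Complex.I * a * ex a t) t := by
  unfold ex
  have h : HasDerivAt (fun t : ℝ => 2 * Real.pi * Complex.I * a * (t : ℂ))
    (2 * Real.pi * Complex.I * a * 1) t := (Complex.ofRealCLM.hasDerivAt (x := t)).const_mul _
  have := h.cexp
  convert this using 1
  ring

lemma C2_approx (lam : ℕ → ℝ) (hlam : IsLandauSystem lam) (N : ℕ) (hN : 0 < N) (L : ℕ)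
    (hL : 0 < L) (h : ℝ) (h0 : 0 < h) (h1 : h < 1) (H : 𝓢(ℝ, ℂ)) (hH : HasCompactSupport H)
    (τ : ℝ) (hτ : 0 < τ) :
    ∃ (s : Finset ℕ) (c : ℕ → ℂ), (∀ n ∈ s, N < n) ∧ ∃ u1 u2 : ℝ → ℂ,
      (∀ x, HasDerivAt (fun t => (∑ n ∈ s, c n * ex (lam n) t) - H t) (u1 x) x) ∧
      (∀ x, HasDerivAt u1 (u2 x) x) ∧
      (∀ x ∈ Om L h, ‖(∑ n ∈ s, c n * ex (lam n) x) - H x‖ ≤ τ ∧ ‖u1 x‖ ≤ τ ∧ ‖u2 x‖ ≤ τ) := by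
  set δ := (1 - h) / 4 with hδ
  have hδ0 : 0 < δ := by rw [hδ]; linarith
  set H1 := derivCLM ℂ ℂ H with hH1
  set H2 := D2 H with hH2
  have dH : ⇑H1 = deriv H := by ext x; rw [hH1, derivCLM_apply]
  have dH1 : ⇑H2 = deriv H1 := by ext x; rw [hH2, D2, ContinuousLinearMap.comp_apply, derivCLM_apply]
  obtain ⟨C0, hC0, hL0⟩ := lip H
  obtain ⟨C1, hC1, hL1⟩ := lip H1
  obtain ⟨C2, hC2, hL2⟩ := lip H2
  set r := min δ (τ / 2 / (C0 + C1 + C2 + 1)) with hr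
  have hr0 : 0 < r := by rw [hr]; positivity
  let φ : ContDiffBump (0 : ℝ) := ⟨r / 2, r, by positivity, by linarith⟩
  have hφr : φ.rOut = r := rfl
  set ψ := φ.normed volume with hψ
  have hsmall : ∀ (F : 𝓢(ℝ, ℂ)) (C : ℝ), 0 ≤ C → C ≤ C0 + C1 + C2 →
      (∀ x y, dist (F x) (F y) ≤ C * dist x y) → ∀ x,
      ‖(ψ ⋆[ContinuousLinearMap.lsmul ℝ ℝ, volume] F) x - F x‖ ≤ τ / 2 := by
    intro F C hC hCC hF x
    rw [← dist_eq_norm]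
    apply ContDiffBump.dist_normed_convolution_le F.continuous.aestronglyMeasurable
    intro y hy
    refine (hF y x).trans ?_
    rw [Metric.mem_ball, hφr] at hy
    have h1 : dist y x ≤ τ / 2 / (C0 + C1 + C2 + 1) := hy.le.trans (min_le_right _ _)
    rw [le_div_iff₀ (by positivity)] at h1
    nlinarith [dist_nonneg (x := y) (y := x)]
  -- smooth bump
  have hψd : ContDiff ℝ ∞ ψ := φ.contDiff_normed
  have hψc : HasCompactSupport ψ := φ.hasCompactSupport_normed
  have hψd1 : ContDiff ℝ ∞ (deriv ψ) := by
    have := (contDiff_infty_iff_deriv.1 hψd).2; exact this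
  have hψd2 : ContDiff ℝ ∞ (deriv (deriv ψ)) := (contDiff_infty_iff_deriv.1 hψd1).2
  have hψc1 : HasCompactSupport (deriv ψ) := hψc.deriv
  have hψc2 : HasCompactSupport (deriv (deriv ψ)) := hψc1.deriv
  have ts : tsupport ψ ⊆ {t | |t| ≤ δ} := by
    rw [hψ, φ.tsupport_normed_eq]
    intro t ht
    rw [Metric.mem_closedBall, Real.dist_eq, sub_zero, hφr] at ht
    exact ht.trans (min_le_left _ _)
  have ts1 : tsupport (deriv ψ) ⊆ {t | |t| ≤ δ} := (closure_minimal support_deriv_subset (isClosed_tsupport ψ)).trans ts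
  have ts2 : tsupport (deriv (deriv ψ)) ⊆ {t | |t| ≤ δ} :=
    (closure_minimal support_deriv_subset (isClosed_tsupport _)).trans ts1
  have van : ∀ f : ℝ → ℝ, tsupport f ⊆ {t | |t| ≤ δ} → ∀ t, δ < |t| → f t = 0 := by
    intro f hf t ht
    by_contra hne
    exact absurd (hf (subset_tsupport f hne)) (not_le.2 ht)
  obtain ⟨K0, hK0⟩ := hψc.exists_bound_of_continuous hψd.continuous
  obtain ⟨K1, hK1⟩ := hψc1.exists_bound_of_continuous hψd1.continuous
  obtain ⟨K2, hK2⟩ := hψc2.exists_bound_of_continuous hψd2.continuous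
  have hK00 := (norm_nonneg _).trans (hK0 0)
  have hK10 := (norm_nonneg _).trans (hK1 0)
  have hK20 := (norm_nonneg _).trans (hK2 0)
  set K := K0 + K1 + K2 + 1 with hK
  have hKp : 0 < K := by positivity
  obtain ⟨p, hp, hpH⟩ := density_L1 lam hlam N hN L hL (h + 2 * δ) (by positivity)
    (by rw [hδ]; linarith) H (τ / 2 / K) (by positivity)
  set R : ℝ → ℂ := fun t => ep lam p t - H t with hR
  have hRc : Continuous R := (ep_continuous _ _).sub H.continuous
  have hb : ∀ f : ℝ → ℝ, Continuous f → tsupport f ⊆ {t | |t| ≤ δ} → (∀ t, ‖f t‖ ≤ K) →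
      ∀ x ∈ Om L h, ‖(f ⋆[ContinuousLinearMap.lsmul ℝ ℝ, volume] R) x‖ ≤ τ / 2 := by
    intro f hf hft hfK x hx
    refine (conv_bound L h δ hδ0 f hf (van f hft) K hfK R hRc x hx).trans ?_
    calc K * _ ≤ K * (τ / 2 / K) := by gcongr
      _ = τ / 2 := by field_simp
  have hHc1 : HasCompactSupport H1 := by rw [dH]; exact hH.deriv
  have hHi : ∀ F : 𝓢(ℝ, ℂ), ContDiff ℝ 1 F := fun F => F.smooth 1
  have hRl : LocallyIntegrable R volume := hRc.locallyIntegrable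
  have hψl : LocallyIntegrable ψ volume := hψd.continuous.locallyIntegrable
  refine ⟨p.support, fun n => p n * ∫ t, ψ t * ex (lam n) (-t), hp,
    fun x => (deriv ψ ⋆[ContinuousLinearMap.lsmul ℝ ℝ, volume] R) x +
      ((ψ ⋆[ContinuousLinearMap.lsmul ℝ ℝ, volume] H1) x - H1 x),
    fun x => (deriv (deriv ψ) ⋆[ContinuousLinearMap.lsmul ℝ ℝ, volume] R) x +
      ((ψ ⋆[ContinuousLinearMap.lsmul ℝ ℝ, volume] H2) x - H2 x), ?_, ?_, ?_⟩
  all_goals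
    have hu : ∀ t, (∑ n ∈ p.support, (p n * ∫ t, ψ t * ex (lam n) (-t)) * ex (lam n) t) - H t =
      (ψ ⋆[ContinuousLinearMap.lsmul ℝ ℝ, volume] R) t +
      ((ψ ⋆[ContinuousLinearMap.lsmul ℝ ℝ, volume] H) t - H t) := by
      intro t
      rw [← conv_ep lam p ψ hψd.continuous hψc]
      have : ep lam p = R + H := by ext t; simp [hR]
      rw [this, ConvolutionExistsAt.distrib_add]
      · ring
      · exact hψc.convolutionExists_left _ hψd.continuous hRl t
      · exact hψc.convolutionExists_left _ hψd.continuous H.continuous.locallyIntegrable t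
  · intro x
    simp only [hu]
    refine (hψc.hasDerivAt_convolution_left _ (hψd.of_le (by exact_mod_cast le_top)) hRl x).add (.sub ?_ ?_)
    · have := hH.hasDerivAt_convolution_right (ContinuousLinearMap.lsmul ℝ ℝ) hψl (hHi H) x
      rw [← dH] at this
      exact this
    · rw [dH]; exact H.differentiableAt.hasDerivAt
  · intro x
    refine (hψc1.hasDerivAt_convolution_left _ (hψd1.of_le (by exact_mod_cast le_top)) hRl x).add (.sub ?_ ?_)
    · have := hHc1.hasDerivAt_convolution_right (ContinuousLinearMap.lsmul ℝ ℝ) hψl (hHi H1) x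
      rw [← dH1] at this
      exact this
    · rw [dH1]; exact H1.differentiableAt.hasDerivAt
  · intro x hx
    rw [hu]
    have hτ2 : τ = τ / 2 + τ / 2 := by ring
    refine ⟨?_, ?_, ?_⟩
    · rw [hτ2]
      exact (norm_add_le _ _).trans (add_le_add
        (hb ψ hψd.continuous ts (fun t => (hK0 t).trans (by rw [hK]; linarith)) x hx)
        (hsmall H C0 hC0 (by linarith) hL0 x))
    · rw [hτ2]
      exact (norm_add_le _ _).trans (add_le_add
        (hb _ hψd1.continuous ts1 (fun t => (hK1 t).trans (by rw [hK]; linarith)) x hx)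
        (hsmall H1 C1 hC1 (by linarith) hL1 x))
    · rw [hτ2]
      exact (norm_add_le _ _).trans (add_le_add
        (hb _ hψd2.continuous ts2 (fun t => (hK2 t).trans (by rw [hK]; linarith)) x hx)
        (hsmall H2 C2 hC2 (by linarith) hL2 x))

/-- Modulation on Schwartz space. -/
def Mo (a : ℝ) : 𝓢(ℝ, ℂ) →L[ℂ] 𝓢(ℝ, ℂ) :=
  (FourierTransform.fourierCLE ℂ 𝓢(ℝ, ℂ)).symm.toContinuousLinearMap.comp
    ((compSubConstCLM ℂ a).comp (FourierTransform.fourierCLE ℂ 𝓢(ℝ, ℂ)).toContinuousLinearMap)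

lemma fourier_Mo (a : ℝ) (γ : 𝓢(ℝ, ℂ)) (x : ℝ) : 𝓕 (Mo a γ) x = 𝓕 γ (x - a) := by
  have : 𝓕 (Mo a γ) = compSubConstCLM ℂ a (𝓕 γ) := by
    have h : Mo a γ = 𝓕⁻ (compSubConstCLM ℂ a (𝓕 γ)) := rfl
    rw [h, FourierTransform.fourier_fourierInv_eq]
  rw [this, compSubConstCLM_apply]

lemma Mo_apply (a : ℝ) (γ : 𝓢(ℝ, ℂ)) (t : ℝ) : Mo a γ t = ex a t * γ t := by
  have h : Mo a γ = 𝓕⁻ (compSubConstCLM ℂ a (𝓕 γ)) := rfl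
  have h2 : γ = 𝓕⁻ (𝓕 γ) := (FourierTransform.fourierInv_fourier_eq γ).symm
  rw [h]
  conv_rhs => rw [h2]
  rw [fourierInv_coe, fourierInv_coe, Real.fourierInv_eq', Real.fourierInv_eq',
    ← integral_const_mul,
    ← integral_sub_right_eq_self (fun v => ex a t * (Complex.exp (↑(2 * Real.pi * inner ℝ v t) * Complex.I) • (𝓕 γ : 𝓢(ℝ, ℂ)) v)) a]
  refine integral_congr_ae (ae_of_all _ fun v => ?_)
  simp only [compSubConstCLM_apply, smul_eq_mul, ← mul_assoc, ex, ← Complex.exp_add]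
  congr 2
  simp
  ring

lemma deriv_zero_off (S : Set ℝ) (hS : IsClosed S) (F : 𝓢(ℝ, ℂ)) (hF : ∀ x ∉ S, F x = 0) :
    ∀ x ∉ S, derivCLM ℂ ℂ F x = 0 := by
  intro x hx
  rw [derivCLM_apply]
  have : F =ᶠ[𝓝 x] fun _ => 0 := by
    filter_upwards [hS.isOpen_compl.mem_nhds hx] with y hy using hF y hy
  rw [this.deriv_eq]; simp

lemma quotient (F γ : 𝓢(ℝ, ℂ)) (hF : HasCompactSupport F) (hs : ∀ x ∈ tsupport F, γ x ≠ 0) :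
    ∃ H : 𝓢(ℝ, ℂ), HasCompactSupport H ∧ ∀ x, F x = H x * γ x := by
  have hc : HasCompactSupport fun x => F x / γ x := by
    apply HasCompactSupport.intro hF
    intro x hx
    rw [image_eq_zero_of_notMem_tsupport hx, zero_div]
  have hd : ContDiff ℝ ∞ fun x => F x / γ x := by
    rw [contDiff_iff_contDiffAt]
    intro x
    by_cases hx : x ∈ tsupport F
    · simp only [div_eq_mul_inv]
      exact (F.smooth ⊤).contDiffAt.mul ((γ.smooth ⊤).contDiffAt.inv (hs x hx))
    · have : (fun x => F x / γ x) =ᶠ[𝓝 x] fun _ => 0 := by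
        filter_upwards [(isClosed_tsupport F).isOpen_compl.mem_nhds hx] with y hy
        rw [image_eq_zero_of_notMem_tsupport hy, zero_div]
      exact contDiffAt_const.congr_of_eventuallyEq this
  refine ⟨hc.toSchwartzMap hd, hc, fun x => ?_⟩
  change F x = F x / γ x * γ x
  by_cases hx : x ∈ tsupport F
  · rw [div_mul_cancel₀ _ (hs x hx)]
  · rw [image_eq_zero_of_notMem_tsupport hx]; simp

lemma key (lam : ℕ → ℝ) (hlam : IsLandauSystem lam) (N : ℕ) (hN : 0 < N) (L : ℕ)
    (hL : 0 < L) (h : ℝ) (h0 : 0 < h) (h1 : h < 1) (γ F : 𝓢(ℝ, ℂ)) (hγ : ∀ x ∉ Om L h, γ x = 0)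
    (hF : HasCompactSupport F) (hs : ∀ x ∈ tsupport F, γ x ≠ 0) (η : ℝ) (hη : 0 < η) :
    ∃ (s : Finset ℕ) (c : ℕ → ℂ), (∀ n ∈ s, N < n) ∧
      ‖E ((∑ n ∈ s, c n • Mo (lam n) γ) - F)‖ < η := by
  obtain ⟨H, hHc, hFH⟩ := quotient F γ hF hs
  have hcl : IsClosed (Om L h) := (Om_compact L h).isClosed
  have hγ1 := deriv_zero_off _ hcl γ hγ
  have hγ2 : ∀ x ∉ Om L h, D2 γ x = 0 := deriv_zero_off _ hcl _ hγ1
  set A := (∫ x, ‖γ x‖) + ((∫ x, ‖γ x‖) + 2 * (∫ x, ‖derivCLM ℂ ℂ γ x‖) + ∫ x, ‖D2 γ x‖) with hA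
  have hA0 : 0 ≤ A := by positivity
  obtain ⟨s, c, hc, u1, u2, hu, hu1, hb⟩ := C2_approx lam hlam N hN L hL h h0 h1 H hHc
    (η / (A + 1)) (by positivity)
  refine ⟨s, c, hc, ?_⟩
  set τ := η / (A + 1) with hτ
  have hτ0 : 0 ≤ τ := by positivity
  set D := (∑ n ∈ s, c n • Mo (lam n) γ) - F with hD
  have hDx : ∀ x, D x = ((∑ n ∈ s, c n * ex (lam n) x) - H x) * γ x := by
    intro x
    rw [hD, sub_apply, sum_apply, hFH x, sub_mul, Finset.sum_mul]
    congr 1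
    refine Finset.sum_congr rfl fun n _ => ?_
    rw [smul_apply, Mo_apply, smul_eq_mul, mul_assoc]
  have hD2 := D2_mul γ D _ u1 u2 hu hu1 hDx
  have b1 : ∫ x, ‖D x‖ ≤ τ * ∫ x, ‖γ x‖ := by
    rw [← integral_const_mul]
    apply integral_mono D.integrable.norm (γ.integrable.norm.const_mul _)
    intro x
    beta_reduce
    by_cases hx : x ∈ Om L h
    · rw [hDx, norm_mul]
      gcongr
      exact (hb x hx).1
    · rw [hDx, hγ x hx]; simp
  have b2 : ∫ x, ‖D2 D x‖ ≤ τ * ((∫ x, ‖γ x‖) + 2 * (∫ x, ‖derivCLM ℂ ℂ γ x‖) + ∫ x, ‖D2 γ x‖) := by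
    have i1 := γ.integrable (μ := volume).norm
    have i2 := (derivCLM ℂ ℂ γ).integrable (μ := volume).norm
    have i3 := (D2 γ).integrable (μ := volume).norm
    have i4 : Integrable (fun x => ‖γ x‖ + 2 * ‖derivCLM ℂ ℂ γ x‖) := i1.add (i2.const_mul 2)
    have i5 : Integrable (fun x => ‖γ x‖ + 2 * ‖derivCLM ℂ ℂ γ x‖ + ‖D2 γ x‖) := i4.add i3
    rw [← integral_const_mul 2, ← integral_add i1 (i2.const_mul 2),
      ← integral_add i4 i3, ← integral_const_mul]
    apply integral_mono (D2 D).integrable.norm (i5.const_mul _)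
    intro x
    beta_reduce
    by_cases hx : x ∈ Om L h
    · obtain ⟨q1, q2, q3⟩ := hb x hx
      rw [hD2]
      refine (norm_add₃_le ..).trans ?_
      simp only [norm_mul, Complex.norm_ofNat]
      have := mul_le_mul_of_nonneg_right q3 (norm_nonneg (γ x))
      have := mul_le_mul_of_nonneg_right q2 (norm_nonneg (derivCLM ℂ ℂ γ x))
      have := mul_le_mul_of_nonneg_right q1 (norm_nonneg (D2 γ x))
      nlinarith
    · rw [hD2, hγ x hx, hγ1 x hx, hγ2 x hx]; simp
  calc ‖E D‖ ≤ _ := norm_E_le D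
    _ ≤ τ * A := by rw [hA]; linarith
    _ < η := by
      rw [hτ, div_mul_eq_mul_div, div_lt_iff₀ (by positivity)]
      nlinarith

lemma gam_aux (k : ℕ) : ∃ γ : 𝓢(ℝ, ℂ), (∀ x ∉ O k, γ x = 0) ∧
    (∀ x, 0 ≤ (γ x).re ∧ (γ x).im = 0) ∧ (∀ x ∈ O k, 0 < (γ x).re) ∧
    (∀ x, 0 ≤ (𝓕 γ x).re ∧ (𝓕 γ x).im = 0) := by
  let S : Set ℝ := {t | ∃ l : ℕ, l ≤ k ∧ |t - l| < hk k / 4}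
  have hS : IsOpen S := by
    have : S = ⋃ l : ℕ, ⋃ _ : l ≤ k, {t : ℝ | |t - l| < hk k / 4} := by
      ext t; simp [S]
    rw [this]
    refine isOpen_iUnion fun l => isOpen_iUnion fun _ => ?_
    exact isOpen_lt (by fun_prop) continuous_const
  obtain ⟨b, hb1, hb2, hb3⟩ := hS.exists_contDiff_support_eq (n := ⊤)
  have hb0 : ∀ t, 0 ≤ b t := fun t => (hb3 ⟨t, rfl⟩).1
  have hbc : HasCompactSupport b := by
    apply HasCompactSupport.intro (isCompact_Icc (a := (-1 : ℝ)) (b := k + 1))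
    intro t ht
    by_contra hne
    have : t ∈ S := by rw [← hb1]; exact hne
    obtain ⟨l, hl, hl2⟩ := this
    rw [abs_lt] at hl2
    have h3 := hk_lt k
    have h4 : (l : ℝ) ≤ k := by exact_mod_cast hl
    have h5 : (0 : ℝ) ≤ l := by positivity
    exact ht ⟨by linarith, by linarith⟩
  have hbs : ∀ t, b t ≠ 0 ↔ t ∈ S := fun t => by rw [← hb1]; rfl
  let f : 𝓢(ℝ, ℂ) := HasCompactSupport.toSchwartzMap (f := fun t => (b t : ℂ))
    (hbc.comp_left (g := fun x : ℝ => (x : ℂ)) (by simp)) (Complex.ofRealCLM.contDiff.comp hb2)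
  let g : 𝓢(ℝ, ℂ) := HasCompactSupport.toSchwartzMap (f := fun t => (b (-t) : ℂ))
    (HasCompactSupport.comp_homeomorph (f := fun t => (b t : ℂ)) (hbc.comp_left (g := fun x : ℝ => (x : ℂ)) (by simp)) (Homeomorph.neg ℝ))
    (Complex.ofRealCLM.contDiff.comp (hb2.comp contDiff_neg))
  have hf : ∀ t, f t = (b t : ℂ) := fun _ => rfl
  have hg : ∀ t, g t = (b (-t) : ℂ) := fun _ => rfl
  let γ := SchwartzMap.convolution (ContinuousLinearMap.mul ℂ ℂ) f g
  have hγ : ∀ x, γ x = ((∫ t, b t * b (t - x) : ℝ) : ℂ) := by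
    intro x
    rw [← integral_complex_ofReal]
    change SchwartzMap.convolution (ContinuousLinearMap.mul ℂ ℂ) f g x = _
    rw [SchwartzMap.convolution_apply]
    unfold MeasureTheory.convolution
    refine integral_congr_ae (ae_of_all _ fun t => ?_)
    simp [hf, hg]
  have hbcont : Continuous b := hb2.continuous
  refine ⟨γ, ?_, ?_, ?_, ?_⟩
  · intro x hx
    rw [hγ]
    have : ∀ t, b t * b (t - x) = 0 := by
      intro t
      by_contra hne
      obtain ⟨l, hl, h1⟩ := (hbs _).1 (left_ne_zero_of_mul hne)
      obtain ⟨m, hm, h2⟩ := (hbs _).1 (right_ne_zero_of_mul hne)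
      refine hx ⟨(l : ℤ) - m, ?_, ?_⟩
      · rw [abs_le]; omega
      · rw [abs_lt] at *
        push_cast
        constructor <;> linarith
    simp [this]
  · intro x
    rw [hγ]
    refine ⟨?_, Complex.ofReal_im _⟩
    rw [Complex.ofReal_re]
    exact integral_nonneg fun t => mul_nonneg (hb0 _) (hb0 _)
  · intro x hx
    rw [hγ, Complex.ofReal_re]
    obtain ⟨l, hl, h1⟩ := hx
    obtain ⟨t, ht1, ht2⟩ : ∃ t, t ∈ S ∧ t - x ∈ S := by
      rw [abs_lt] at h1
      rcases le_total 0 l with h0 | h0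
      · lift l to ℕ using h0
        have hl' : l ≤ k := by rw [Nat.abs_cast] at hl; exact_mod_cast hl
        push_cast at h1
        refine ⟨l + (x - l) / 2, ⟨l, hl', ?_⟩, ⟨0, by omega, ?_⟩⟩
        · rw [abs_lt]; constructor <;> linarith
        · rw [abs_lt]; push_cast; constructor <;> linarith
      · obtain ⟨m, rfl⟩ : ∃ m : ℕ, l = -(m : ℤ) := ⟨l.natAbs, by omega⟩
        have hl' : m ≤ k := by rw [abs_neg, Nat.abs_cast] at hl; exact_mod_cast hl
        push_cast at h1
        refine ⟨(x + m) / 2, ⟨0, by omega, ?_⟩, ⟨m, hl', ?_⟩⟩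
        · rw [abs_lt]; push_cast; constructor <;> linarith
        · rw [abs_lt]; constructor <;> linarith
    apply Continuous.integral_pos_of_hasCompactSupport_nonneg_nonzero (x := t)
    · exact hbcont.mul (hbcont.comp (by fun_prop))
    · exact hbc.mul_right
    · exact fun t => mul_nonneg (hb0 _) (hb0 _)
    · exact mul_ne_zero ((hbs _).2 ht1) ((hbs _).2 ht2)
  · intro x
    have h1 : 𝓕 γ x = 𝓕 f x * 𝓕 g x := by
      change 𝓕 (SchwartzMap.convolution (ContinuousLinearMap.mul ℂ ℂ) f g) x = _
      rw [SchwartzMap.fourier_convolution, pairing_apply_apply]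
      rfl
    have h2 : 𝓕 g x = (starRingEnd ℂ) (𝓕 f x) := by
      rw [fourier_coe, fourier_coe, Real.fourier_eq', Real.fourier_eq', ← integral_conj,
        ← integral_neg_eq_self]
      refine integral_congr_ae (ae_of_all _ fun t => ?_)
      simp only [hf, hg, smul_eq_mul, map_mul, Complex.conj_ofReal, neg_neg, ← Complex.exp_conj]
      congr 2
      simp
    rw [h1, h2, Complex.mul_conj]
    exact ⟨by rw [Complex.ofReal_re]; exact Complex.normSq_nonneg _, Complex.ofReal_im _⟩

lemma gam_exists (k : ℕ) : ∃ γ : 𝓢(ℝ, ℂ), (∀ x ∉ O k, γ x = 0) ∧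
    (∀ x, 0 ≤ (γ x).re ∧ (γ x).im = 0) ∧ (∀ x ∈ O k, 0 < (γ x).re) ∧
    (∀ x, 0 ≤ (𝓕 γ x).re ∧ (𝓕 γ x).im = 0) ∧
    (∀ m n : ℕ, m ≤ k → n ≤ k → SchwartzMap.seminorm ℝ m n γ ≤ (1 / 2) ^ k) := by
  obtain ⟨γ, h1, h2, h3, h4⟩ := gam_aux k
  set A := (∑ m ∈ Finset.range (k + 1), ∑ n ∈ Finset.range (k + 1), SchwartzMap.seminorm ℝ m n γ) + 1
    with hA
  have hs0 : ∀ m n, 0 ≤ SchwartzMap.seminorm ℝ m n γ := fun m n => apply_nonneg _ _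
  have hA1 : ∀ m n, m ≤ k → n ≤ k → SchwartzMap.seminorm ℝ m n γ ≤ A := by
    intro m n hm hn
    have e1 := Finset.single_le_sum (f := fun n => SchwartzMap.seminorm ℝ m n γ)
      (s := Finset.range (k + 1)) (fun n _ => hs0 m n) (Finset.mem_range.2 (by omega : n < k + 1))
    have e2 := Finset.single_le_sum
      (f := fun m => ∑ n ∈ Finset.range (k + 1), SchwartzMap.seminorm ℝ m n γ)
      (s := Finset.range (k + 1)) (fun m _ => Finset.sum_nonneg fun n _ => hs0 m n)
      (Finset.mem_range.2 (by omega : m < k + 1))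
    rw [hA]; linarith
  have hA0 : 0 < A := by
    have := Finset.sum_nonneg (s := Finset.range (k + 1))
      (f := fun m => ∑ n ∈ Finset.range (k + 1), SchwartzMap.seminorm ℝ m n γ)
      fun m _ => Finset.sum_nonneg fun n _ => hs0 m n
    rw [hA]; linarith
  set a := (1 / 2 : ℝ) ^ k / A with ha
  have ha0 : 0 < a := by positivity
  have hsm : ∀ x, (a • γ) x = (a : ℂ) * γ x := fun x => by
    rw [smul_apply, Complex.real_smul]
  have hfm : ∀ x, 𝓕 (a • γ) x = (a : ℂ) * 𝓕 γ x := fun x => by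
    have : a • γ = (a : ℂ) • γ := by ext x; simp
    rw [this, FourierTransform.fourier_smul, smul_apply, smul_eq_mul]
  refine ⟨a • γ, ?_, ?_, ?_, ?_, ?_⟩
  · intro x hx; rw [hsm, h1 x hx, mul_zero]
  · intro x
    rw [hsm, Complex.re_ofReal_mul, Complex.im_ofReal_mul, (h2 x).2, mul_zero]
    exact ⟨mul_nonneg ha0.le (h2 x).1, rfl⟩
  · intro x hx
    rw [hsm, Complex.re_ofReal_mul]
    exact mul_pos ha0 (h3 x hx)
  · intro x
    rw [hfm, Complex.re_ofReal_mul, Complex.im_ofReal_mul, (h4 x).2, mul_zero]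
    exact ⟨mul_nonneg ha0.le (h4 x).1, rfl⟩
  · intro m n hm hn
    rw [map_smul_eq_mul, Real.norm_eq_abs, abs_of_pos ha0, ha, div_mul_eq_mul_div, div_le_iff₀ hA0]
    gcongr
    exact hA1 m n hm hn

/-- The building blocks. -/
def gam (k : ℕ) : 𝓢(ℝ, ℂ) := (gam_exists k).choose

lemma gam_spec (k : ℕ) : (∀ x ∉ O k, gam k x = 0) ∧
    (∀ x, 0 ≤ (gam k x).re ∧ (gam k x).im = 0) ∧ (∀ x ∈ O k, 0 < (gam k x).re) ∧
    (∀ x, 0 ≤ (𝓕 (gam k) x).re ∧ (𝓕 (gam k) x).im = 0) ∧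
    (∀ m n : ℕ, m ≤ k → n ≤ k → SchwartzMap.seminorm ℝ m n (gam k) ≤ (1 / 2) ^ k) :=
  (gam_exists k).choose_spec

lemma schwartz_sum (f : ℕ → 𝓢(ℝ, ℂ)) (hf : ∀ m n, Summable fun k => SchwartzMap.seminorm ℝ m n (f k)) :
    ∃ g : 𝓢(ℝ, ℂ), (∀ x, HasSum (fun k => f k x) (g x)) ∧
      ∀ m n, SchwartzMap.seminorm ℝ m n g ≤ ∑' k, SchwartzMap.seminorm ℝ m n (f k) := by
  have hd : ∀ k, ContDiff ℝ ((⊤ : ℕ∞) : WithTop ℕ∞) (f k) := fun k => (f k).smooth ⊤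
  have hb : ∀ (n k : ℕ) (x : ℝ), (n : ℕ∞) ≤ ⊤ →
      ‖iteratedFDeriv ℝ n (f k) x‖ ≤ SchwartzMap.seminorm ℝ 0 n (f k) :=
    fun n k x _ => norm_iteratedFDeriv_le_seminorm ℝ (f k) n x
  have hdec : ∀ m n x, ‖x‖ ^ m * ‖iteratedFDeriv ℝ n (fun y => ∑' k, f k y) x‖ ≤
      ∑' k, SchwartzMap.seminorm ℝ m n (f k) := by
    intro m n x
    rw [iteratedFDeriv_tsum_apply hd (fun n _ => hf 0 n) hb le_top]
    have hs : Summable fun k => ‖iteratedFDeriv ℝ n (f k) x‖ :=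
      (hf 0 n).of_nonneg_of_le (fun _ => norm_nonneg _) (fun k => hb n k x le_top)
    calc _ ≤ ‖x‖ ^ m * ∑' k, ‖iteratedFDeriv ℝ n (f k) x‖ := by
          gcongr
          exact norm_tsum_le_tsum_norm hs
      _ = ∑' k, ‖x‖ ^ m * ‖iteratedFDeriv ℝ n (f k) x‖ := tsum_mul_left.symm
      _ ≤ _ := (hs.mul_left _).tsum_le_tsum (fun k => le_seminorm ℝ m n (f k) x) (hf m n)
  let g : 𝓢(ℝ, ℂ) :=
    { toFun := fun y => ∑' k, f k y
      smooth' := contDiff_tsum hd (fun n _ => hf 0 n) hb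
      decay' := fun m n => ⟨_, hdec m n⟩ }
  refine ⟨g, fun x => ?_, fun m n => ?_⟩
  · refine Summable.hasSum (Summable.of_norm_bounded (hf 0 0) fun k => ?_)
    exact norm_le_seminorm ℝ (f k) x
  · exact seminorm_le_bound ℝ m n g (tsum_nonneg fun k => apply_nonneg _ _) (hdec m n)

lemma sum_gam (m n : ℕ) : Summable fun k => SchwartzMap.seminorm ℝ m n (gam k) := by
  refine Summable.of_norm_bounded_eventually_nat (g := fun k => (1 / 2 : ℝ) ^ k)
    (summable_geometric_of_lt_one (by norm_num) (by norm_num)) ?_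
  filter_upwards [eventually_ge_atTop (max m n)] with k hk
  rw [Real.norm_eq_abs, abs_of_nonneg (apply_nonneg _ _)]
  exact (gam_spec k).2.2.2.2 m n ((le_max_left _ _).trans hk) ((le_max_right _ _).trans hk)

/-- Parameter space. -/
abbrev X := ℕ → Set.Icc (0 : ℝ) 1

lemma sum_smul_gam (a : ℕ → ℝ) (ha : ∀ k, |a k| ≤ 1) (m n : ℕ) :
    Summable fun k => SchwartzMap.seminorm ℝ m n (a k • gam k) := by
  refine (sum_gam m n).of_nonneg_of_le (fun _ => apply_nonneg _ _) fun k => ?_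
  rw [map_smul_eq_mul, Real.norm_eq_abs]
  exact mul_le_of_le_one_left (apply_nonneg _ _) (ha k)

lemma X_abs (e : X) (k : ℕ) : |(e k : ℝ)| ≤ 1 := by
  rw [abs_of_nonneg (e k).2.1]; exact (e k).2.2

/-- The generator attached to a parameter. -/
def G (e : X) : 𝓢(ℝ, ℂ) :=
  (schwartz_sum (fun k => (e k : ℝ) • gam k) (sum_smul_gam _ (X_abs e))).choose

lemma G_hasSum (e : X) (x : ℝ) : HasSum (fun k => ((e k : ℝ) : ℂ) * gam k x) (G e x) := by
  have := (schwartz_sum (fun k => (e k : ℝ) • gam k) (sum_smul_gam _ (X_abs e))).choose_spec.1 x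
  simp only [smul_apply, Complex.real_smul] at this
  exact this

lemma G_continuous : Continuous G := by
  rw [continuous_iff_continuousAt]
  intro e0
  rw [ContinuousAt, (schwartz_withSeminorms ℝ ℝ ℂ).tendsto_nhds]
  rintro ⟨m, n⟩ ε hε
  let Φ : X → ℝ := fun e => ∑' k, |(e k : ℝ) - e0 k| * SchwartzMap.seminorm ℝ m n (gam k)
  have hab : ∀ (e : X) k, |(e k : ℝ) - e0 k| ≤ 1 := by
    intro e k
    have := (e k).2
    have := (e0 k).2
    rw [abs_le]; constructor <;> linarith [(e k).2.1, (e k).2.2, (e0 k).2.1, (e0 k).2.2]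
  have hΦ : Continuous Φ := by
    refine continuous_tsum (fun k => ?_) (sum_gam m n) fun k e => ?_
    · fun_prop
    · rw [norm_mul, Real.norm_eq_abs, Real.norm_eq_abs, abs_abs,
        abs_of_nonneg (apply_nonneg (SchwartzMap.seminorm ℝ m n) (gam k))]
      exact mul_le_of_le_one_left (apply_nonneg _ _) (hab e k)
  have hΦ0 : Φ e0 = 0 := by simp [Φ]
  have hle : ∀ e, SchwartzMap.seminorm ℝ m n (G e - G e0) ≤ Φ e := by
    intro e
    obtain ⟨g, hg1, hg2⟩ := schwartz_sum (fun k => ((e k : ℝ) - e0 k) • gam k)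
      (sum_smul_gam _ (hab e))
    have : g = G e - G e0 := by
      ext x
      rw [sub_apply]
      refine (hg1 x).unique ?_
      have hk2 : (fun k => (((e k : ℝ) - e0 k) • gam k) x) =
          fun k => ((e k : ℝ) : ℂ) * gam k x - ((e0 k : ℝ) : ℂ) * gam k x := by
        ext k
        rw [smul_apply, Complex.real_smul]; push_cast; ring
      rw [hk2]
      exact (G_hasSum e x).sub (G_hasSum e0 x)
    rw [← this]
    refine (hg2 m n).trans (le_of_eq ?_)
    refine tsum_congr fun k => ?_
    rw [map_smul_eq_mul, Real.norm_eq_abs]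
  have := hΦ.tendsto e0
  rw [hΦ0] at this
  filter_upwards [this.eventually (gt_mem_nhds hε)] with e he
  exact (hle e).trans_lt he

/-- Truncation with last value `a`. -/
def trunc (K : ℕ) (a : Set.Icc (0 : ℝ) 1) (e : X) : X :=
  fun k => if k < K then e k else if k = K then a else 0

lemma trunc_tendsto (a : Set.Icc (0 : ℝ) 1) (e : X) : Tendsto (fun K => trunc K a e) atTop (𝓝 e) := by
  rw [tendsto_pi_nhds]
  intro k
  apply tendsto_const_nhds.congr'
  filter_upwards [eventually_gt_atTop k] with K hK
  simp [trunc, hK]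

lemma G_fourier_nonneg (e : X) (x : ℝ) : 0 ≤ (𝓕 (G e) x).re ∧ (𝓕 (G e) x).im = 0 := by
  have hc : Continuous fun e : X => 𝓕 (G e) x := by
    have h1 : Continuous fun e : X => (FourierTransform.fourierCLE ℂ 𝓢(ℝ, ℂ) (G e)) :=
      (ContinuousLinearEquiv.continuous _).comp G_continuous
    have h2 : Continuous fun F : 𝓢(ℝ, ℂ) => F x := by
      have := (SchwartzMap.toBoundedContinuousFunctionCLM ℂ ℝ ℂ).continuous
      exact (BoundedContinuousFunction.lipschitz_eval_const x).continuous.comp this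
    exact h2.comp h1
  have ht : Tendsto (fun K => 𝓕 (G (trunc K 0 e)) x) atTop (𝓝 (𝓕 (G e) x)) :=
    (hc.tendsto e).comp (trunc_tendsto 0 e)
  have hcl : IsClosed {z : ℂ | 0 ≤ z.re ∧ z.im = 0} :=
    (isClosed_le continuous_const Complex.continuous_re).inter
      (isClosed_eq Complex.continuous_im continuous_const)
  refine hcl.mem_of_tendsto ht (Eventually.of_forall fun K => ?_)
  have hG : G (trunc K 0 e) = ∑ k ∈ Finset.range K, ((e k : ℝ) : ℂ) • gam k := by
    ext x
    refine (G_hasSum _ x).unique ?_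
    rw [sum_apply]
    have : ∀ k ∈ Finset.range K, (((e k : ℝ) : ℂ) • gam k) x =
        (((trunc K 0 e) k : ℝ) : ℂ) * gam k x := by
      intro k hk
      rw [smul_apply, smul_eq_mul, trunc, if_pos (Finset.mem_range.1 hk)]
    rw [Finset.sum_congr rfl this]
    apply hasSum_sum_of_ne_finset_zero
    intro k hk
    simp only [trunc]
    rw [if_neg (by simpa using hk)]
    split <;> simp
  have hF : 𝓕 (G (trunc K 0 e)) x = ∑ k ∈ Finset.range K, ((e k : ℝ) : ℂ) * 𝓕 (gam k) x := by
    rw [hG]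
    change (FourierTransform.fourierCLE ℂ 𝓢(ℝ, ℂ)) (∑ k ∈ Finset.range K, ((e k : ℝ) : ℂ) • gam k) x = _
    rw [map_sum, sum_apply]
    refine Finset.sum_congr rfl fun k _ => ?_
    rw [map_smul, smul_apply, smul_eq_mul]
    rfl
  change 0 ≤ (𝓕 (G (trunc K 0 e)) x).re ∧ (𝓕 (G (trunc K 0 e)) x).im = 0
  rw [hF, Complex.re_sum, Complex.im_sum]
  constructor
  · refine Finset.sum_nonneg fun k _ => ?_
    rw [Complex.re_ofReal_mul]
    exact mul_nonneg (e k).2.1 ((gam_spec k).2.2.2.1 x).1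
  · refine Finset.sum_eq_zero fun k _ => ?_
    rw [Complex.im_ofReal_mul, ((gam_spec k).2.2.2.1 x).2, mul_zero]

lemma O_sub_Om (k : ℕ) : O k ⊆ Om k (hk k) := by
  rintro t ⟨l, h1, h2⟩
  exact mem_Om.2 ⟨l, h1, h2.le⟩

lemma G_trunc_zero (K : ℕ) (e : X) (x : ℝ) (hx : x ∉ Om K (hk K)) : G (trunc K 1 e) x = 0 := by
  refine (G_hasSum _ x).unique ?_
  convert hasSum_zero with k
  by_cases h : k ≤ K
  · rw [(gam_spec k).1 x fun h' => hx (O_sub_Om K (O_mono h h')), mul_zero]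
  · simp [trunc, show ¬ k < K by omega, show ¬ k = K by omega]

lemma G_trunc_ne (K : ℕ) (e : X) (x : ℝ) (hx : x ∈ O K) : G (trunc K 1 e) x ≠ 0 := by
  have h := Complex.hasSum_re (G_hasSum (trunc K 1 e) x)
  have h2 : ((((trunc K 1 e) K : ℝ) : ℂ) * gam K x).re ≤ (G (trunc K 1 e) x).re := by
    refine le_hasSum h K fun k _ => ?_
    rw [Complex.re_ofReal_mul]
    exact mul_nonneg (trunc K 1 e k).2.1 ((gam_spec k).2.1 x).1
  have h3 : ((((trunc K 1 e) K : ℝ) : ℂ) * gam K x).re = (gam K x).re := by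
    simp [trunc]
  have h4 := (gam_spec K).2.2.1 x hx
  intro h0
  rw [h0, h3] at h2
  simp at h2
  linarith

lemma dense_step (lam : ℕ → ℝ) (hlam : IsLandauSystem lam) (N : ℕ) (hN : 0 < N) (k : ℕ)
    (F : 𝓢(ℝ, ℂ)) (hF : F ∈ Tg k) (η : ℝ) (hη : 0 < η) :
    IsOpen {e : X | ∃ (s : Finset ℕ) (c : ℕ → ℂ), (∀ n ∈ s, N < n) ∧
      ‖E ((∑ n ∈ s, c n • Mo (lam n) (G e)) - F)‖ < η} ∧
    Dense {e : X | ∃ (s : Finset ℕ) (c : ℕ → ℂ), (∀ n ∈ s, N < n) ∧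
      ‖E ((∑ n ∈ s, c n • Mo (lam n) (G e)) - F)‖ < η} := by
  constructor
  · simp only [ofPred_exists]
    refine isOpen_iUnion fun s => isOpen_iUnion fun c => ?_
    by_cases hs : ∀ n ∈ s, N < n
    · have : {e : X | (∀ n ∈ s, N < n) ∧ ‖E ((∑ n ∈ s, c n • Mo (lam n) (G e)) - F)‖ < η} =
          {e : X | ‖E ((∑ n ∈ s, c n • Mo (lam n) (G e)) - F)‖ < η} := by
        ext e; simp only [mem_ofPred_eq]; tauto
      rw [this]
      refine isOpen_lt ?_ continuous_const
      refine (E.continuous.comp (Continuous.sub ?_ continuous_const)).norm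
      refine continuous_finsetSum _ fun n _ => ?_
      exact (((Mo (lam n)).continuous.comp G_continuous).const_smul (c n))
    · have : {e : X | (∀ n ∈ s, N < n) ∧ ‖E ((∑ n ∈ s, c n • Mo (lam n) (G e)) - F)‖ < η} = ∅ := by
        ext e; simp only [mem_ofPred_eq, hs, false_and]; tauto
      rw [this]; exact isOpen_empty
  · intro e
    refine mem_closure_of_tendsto (trunc_tendsto 1 e) ?_
    filter_upwards [eventually_ge_atTop (max k 1)] with K hK
    exact key lam hlam N hN K (by have := (le_max_right k 1).trans hK; omega) (hk K) (hk_pos K)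
      (hk_lt K) _ F (G_trunc_zero K e) hF.1
      (fun x hx => G_trunc_ne K e x (O_mono ((le_max_left _ _).trans hK) (hF.2 hx))) η hη

lemma Tg_countable (k : ℕ) : ∃ S : Set 𝓢(ℝ, ℂ), S.Countable ∧ S ⊆ Tg k ∧
    ∀ F ∈ Tg k, ∀ η > 0, ∃ F' ∈ S, ‖E F - E F'‖ < η := by
  have : Fact ((1 : ℝ≥0∞) ≠ ⊤) := ⟨by simp⟩
  have : SecondCountableTopology (Lp ℂ 1 (volume : Measure ℝ)) :=
    UniformSpace.secondCountable_of_separable _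
  obtain ⟨t, ht1, ht2⟩ := TopologicalSpace.exists_countable_dense (E '' Tg k)
  have hch : ∀ y : (E '' Tg k : Set _), ∃ F ∈ Tg k, E F = y := fun y => y.2
  choose q hq1 hq2 using hch
  refine ⟨q '' t, ht1.image q, ?_, ?_⟩
  · rintro _ ⟨y, _, rfl⟩
    exact hq1 y
  · intro F hF η hη
    obtain ⟨y, hy, hyt⟩ := Metric.dense_iff.1 ht2 ⟨E F, F, hF, rfl⟩ η hη
    refine ⟨q y, ⟨y, hyt, rfl⟩, ?_⟩
    rw [hq2, ← dist_eq_norm, dist_comm]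
    exact hy

lemma exists_param (lam : ℕ → ℝ) (hlam : IsLandauSystem lam) : ∃ e : X,
    ∀ N : ℕ, 0 < N → ∀ k, ∀ F ∈ Tg k, ∀ η > 0,
      ∃ (s : Finset ℕ) (c : ℕ → ℂ), (∀ n ∈ s, N < n) ∧
      ‖E ((∑ n ∈ s, c n • Mo (lam n) (G e)) - F)‖ < η := by
  choose S hS1 hS2 hS3 using Tg_countable
  have hcount : ∀ k, Countable (S k) := fun k => (hS1 k).to_subtype
  let U : (Σ k, S k) × ℕ × ℕ → Set X := fun i =>
    {e : X | ∃ (s : Finset ℕ) (c : ℕ → ℂ), (∀ n ∈ s, i.2.1 + 1 < n) ∧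
      ‖E ((∑ n ∈ s, c n • Mo (lam n) (G e)) - (i.1.2 : 𝓢(ℝ, ℂ)))‖ < 1 / ((i.2.2 : ℝ) + 1)}
  have hU := fun i : (Σ k, S k) × ℕ × ℕ => dense_step lam hlam (i.2.1 + 1) (by omega) i.1.1
    (i.1.2 : 𝓢(ℝ, ℂ)) (hS2 _ i.1.2.2) (1 / ((i.2.2 : ℝ) + 1)) (by positivity)
  have hd : Dense (⋂ i, U i) := dense_iInter_of_isOpen (fun i => (hU i).1) (fun i => (hU i).2)
  obtain ⟨e, he⟩ := hd.nonempty
  refine ⟨e, fun N hN k F hF η hη => ?_⟩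
  obtain ⟨F', hF', hFF⟩ := hS3 k F hF (η / 2) (by positivity)
  obtain ⟨m, hm⟩ := exists_nat_one_div_lt (show 0 < η / 2 by positivity)
  obtain ⟨s, c, hs, hc⟩ := mem_iInter.1 he (⟨k, ⟨F', hF'⟩⟩, N, m)
  refine ⟨s, c, fun n hn => by have := hs n hn; simp only at this; omega, ?_⟩
  have : E ((∑ n ∈ s, c n • Mo (lam n) (G e)) - F) =
      E ((∑ n ∈ s, c n • Mo (lam n) (G e)) - F') - (E F - E F') := by
    rw [map_sub, map_sub]; abel
  rw [this]
  refine (norm_sub_le _ _).trans_lt ?_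
  simp only at hc
  linarith

lemma main_result (lam : ℕ → ℝ) (hlam : IsLandauSystem lam) :
    ∃ g : SchwartzMap ℝ ℝ,
      (∀ x, 0 ≤ g x) ∧
      (∀ N : ℕ, 0 < N → ∀ p : ℝ, (hp : 1 < p) →
        @TranslatesCompleteFrom (⇑g) lam N (ENNReal.ofReal p)
          ⟨ENNReal.one_le_ofReal.mpr hp.le⟩) := by
  obtain ⟨e, he⟩ := exists_param lam hlam
  let g : 𝓢(ℝ, ℝ) := SchwartzMap.postcompCLM Complex.reCLM (𝓕 (G e))
  have hg : ∀ x, g x = (𝓕 (G e) x).re := fun x => rfl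
  have hgc : ∀ x, (g x : ℂ) = 𝓕 (G e) x := fun x => by
    apply Complex.ext
    · rw [Complex.ofReal_re, hg]
    · rw [Complex.ofReal_im, (G_fourier_nonneg e x).2]
  refine ⟨g, fun x => by rw [hg]; exact (G_fourier_nonneg e x).1, fun N hN p hp => ?_⟩
  have : Fact (1 ≤ ENNReal.ofReal p) := ⟨ENNReal.one_le_ofReal.mpr hp.le⟩
  unfold TranslatesCompleteFrom
  rw [Metric.dense_iff]
  intro f r hr
  obtain ⟨k, F, hF, hfF⟩ := target_dense p hp f (r / 2) (by positivity)
  obtain ⟨s, c, hs, hc⟩ := he N hN k F hF (r / 16) (by positivity)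
  let T : 𝓢(ℝ, ℂ) →L[ℂ] Lp ℂ (ENNReal.ofReal p) (volume : Measure ℝ) :=
    (toLpCLM ℂ ℂ (ENNReal.ofReal p) volume).comp
      (FourierTransform.fourierCLE ℂ 𝓢(ℝ, ℂ)).toContinuousLinearMap
  have hT : ∀ F, T F = (𝓕 F).toLp (ENNReal.ofReal p) volume := fun F => rfl
  refine ⟨T (∑ n ∈ s, c n • Mo (lam n) (G e)), ?_, ?_⟩
  · rw [Metric.mem_ball, dist_eq_norm]
    have h1 := fourier_Lp_bound_E ((∑ n ∈ s, c n • Mo (lam n) (G e)) - F) p hp.le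
    rw [← hT, map_sub] at h1
    rw [← hT] at hfF
    have h2 : T (∑ n ∈ s, c n • Mo (lam n) (G e)) - f =
        (T (∑ n ∈ s, c n • Mo (lam n) (G e)) - T F) - (f - T F) := by abel
    rw [h2]
    refine (norm_sub_le _ _).trans_lt ?_
    linarith
  · rw [map_sum]
    refine Submodule.sum_mem _ fun n hn => ?_
    rw [map_smul]
    refine Submodule.smul_mem _ _ (Submodule.subset_span ⟨n, hs n hn, ?_⟩)
    rw [hT]
    filter_upwards [(𝓕 (Mo (lam n) (G e))).coeFn_toLp (ENNReal.ofReal p) volume] with x hx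
    rw [hx, fourier_Mo, hgc]

end LandauProof

end

end Aux

/-- **Translates along a Landau system.**
Given a Landau system `(lam n)`, there is a nonnegative Schwartz function `g` such
that for every positive integer `N` and every `p > 1`, the system of translates
`{x ↦ g (x - lam n) : n > N}` is complete in `L^p(ℝ)`. -/
theorem landau_system_translates_complete
    (lam : ℕ → ℝ) (hlam : IsLandauSystem lam) :
    ∃ g : SchwartzMap ℝ ℝ,
      (∀ x, 0 ≤ g x) ∧
      (∀ N : ℕ, 0 < N → ∀ p : ℝ, (hp : 1 < p) →
        @TranslatesCompleteFrom (⇑g) lam N (ENNReal.ofReal p)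
          ⟨ENNReal.one_le_ofReal.mpr hp.le⟩) := by
  exact LandauProof.main_result lam hlam
end

section
/- Given any 0 < h < 1/6, there exists a nonnegative continuous function φ on the circle 𝕋 = ℝ/ℤ with absolutely convergent Fourier series, with the following properties: (1) φ̂(0) = 1 and φ̂(n) ≥ 0 for all n ∈ ℤ; (2) the set of zeros of φ in the interval [0, 1] is precisely the interval [1/2 − h, 1/2 + h]; (3) ‖φ − 1‖_{A^p(𝕋)} ≤ 6·h^{(p−1)/p} for every p ≥ 1. -/
/-- The `n`-th Fourier coefficient of a (1-periodic) function `f` on the circle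
`𝕋 = ℝ/ℤ`: `f̂(n) = ∫₀¹ f(t) e^{-2πint} dt`. -/
noncomputable def circleFourierCoeff (f : ℝ → ℂ) (n : ℤ) : ℂ :=
  ∫ t in (0 : ℝ)..1, f t * Complex.exp (-2 * Real.pi * Complex.I * n * t)

/-- distance to the nearest integer -/
noncomputable def distZ (t : ℝ) : ℝ := |t - round t|

lemma distZ_cont : Continuous distZ := by
  have : distZ = fun t : ℝ => ‖(t : UnitAddCircle)‖ := by
    ext t; rw [UnitAddCircle.norm_eq]; rfl
  rw [this]
  exact continuous_norm.comp (AddCircle.continuous_mk' 1)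

lemma distZ_periodic : Function.Periodic distZ 1 := by
  intro t
  unfold distZ
  rw [round_add_one]
  push_cast
  congr 1; ring

lemma distZ_nonneg (t : ℝ) : 0 ≤ distZ t := abs_nonneg _

lemma distZ_eq {t : ℝ} (h0 : 0 ≤ t) (h1 : t ≤ 1) : distZ t = min t (1 - t) := by
  unfold distZ
  rw [abs_sub_round_eq_min]
  rcases h1.lt_or_eq with h | h
  · rw [Int.fract_eq_self.2 ⟨h0, h⟩]
  · subst h; simp

lemma distZ_half {t : ℝ} (h0 : 0 ≤ t) (h1 : t ≤ 1) : distZ (t - 1/2) = |t - 1/2| := by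
  rcases le_total t (1/2) with h | h
  · have := distZ_periodic (t - 1/2)
    rw [← this, distZ_eq (by linarith) (by linarith), min_eq_right (by linarith),
      abs_of_nonpos (by linarith)]
    ring
  · rw [distZ_eq (by linarith) (by linarith), min_eq_left (by linarith),
      abs_of_nonneg (by linarith)]

/-- periodic triangle of height and half-width `w` -/
noncomputable def tri (w t : ℝ) : ℝ := max 0 (w - distZ t)

lemma tri_cont (w : ℝ) : Continuous (tri w) := by
  have := distZ_cont
  unfold tri
  fun_prop

lemma tri_periodic (w : ℝ) : Function.Periodic (tri w) 1 := by
  intro t; unfold tri; rw [distZ_periodic t]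

lemma tri_nonneg (w t : ℝ) : 0 ≤ tri w t := le_max_left _ _

/-- The sequence of Fourier coefficients of `tri w` away from zero. -/
noncomputable def triS (w : ℝ) (n : ℤ) : ℝ :=
  Real.sin (Real.pi * n * w) ^ 2 / (Real.pi ^ 2 * (n : ℝ) ^ 2)

lemma triS_nonneg (w : ℝ) (n : ℤ) : 0 ≤ triS w n := by unfold triS; positivity

lemma bern2 (x : ℝ) : (Polynomial.map (algebraMap ℚ ℝ) (Polynomial.bernoulli 2)).eval x
    = x ^ 2 - x + 1 / 6 := by
  simp [Polynomial.bernoulli, Finset.sum_range_succ,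
    bernoulli_one, bernoulli_two]
  ring

lemma triS_hasSum {w : ℝ} (h0 : 0 ≤ w) (h1 : w ≤ 1) : HasSum (triS w) (w - w ^ 2) := by
  have a := hasSum_one_div_nat_pow_mul_cos (k := 1) one_ne_zero (x := w) ⟨h0, h1⟩
  have b := hasSum_one_div_nat_pow_mul_cos (k := 1) one_ne_zero (x := 0) ⟨le_rfl, zero_le_one⟩
  rw [mul_one, bern2] at a b
  have c := (b.sub a).mul_left (1 / (2 * Real.pi ^ 2))
  have e : (fun n : ℕ => triS w n) = fun n : ℕ => 1 / (2 * Real.pi ^ 2) *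
      (1 / (n : ℝ) ^ 2 * Real.cos (2 * Real.pi * n * 0)
        - 1 / (n : ℝ) ^ 2 * Real.cos (2 * Real.pi * n * w)) := by
    ext n
    unfold triS
    rw [Real.sin_sq_eq_half_sub, mul_zero, Real.cos_zero]
    push_cast
    rw [show 2 * (Real.pi * n * w) = 2 * Real.pi * n * w by ring]
    rcases eq_or_ne (n : ℝ) 0 with h | h
    · simp [h]
    · field_simp
  rw [← e] at c
  have d : (fun n : ℕ => triS w (-n)) = fun n : ℕ => triS w n := by
    ext n; unfold triS; push_cast
    rw [show Real.pi * -n * w = -(Real.pi * n * w) by ring, Real.sin_neg]; ring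
  have c2 := c
  rw [← d] at c2
  have z : triS w 0 = 0 := by simp [triS]
  have := HasSum.of_nat_of_neg c c2
  refine (?_ : _ = w - w ^ 2) ▸ this
  rw [z]
  have := Real.pi_ne_zero
  norm_num
  field_simp
  ring

lemma exp_per (n : ℤ) (t : ℝ) : Complex.exp (-2 * Real.pi * Complex.I * n * (t + 1 : ℝ))
    = Complex.exp (-2 * Real.pi * Complex.I * n * t) := by
  rw [show (-2 * Real.pi * Complex.I * n * (t + 1 : ℝ) : ℂ) =
    -2 * Real.pi * Complex.I * n * t + (-n : ℤ) * (2 * Real.pi * Complex.I) by push_cast; ring,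
    Complex.exp_add, Complex.exp_int_mul_two_pi_mul_I, mul_one]

lemma exp_half (n : ℤ) : Complex.exp (-2 * Real.pi * Complex.I * n * (1 / 2 : ℝ)) = (-1) ^ n := by
  rw [show (-2 * Real.pi * Complex.I * n * (1 / 2 : ℝ) : ℂ) =
    n * (-(Real.pi * Complex.I)) by push_cast; ring, Complex.exp_int_mul, Complex.exp_neg,
    Complex.exp_pi_mul_I]
  norm_num

lemma coeff_shift (f : ℝ → ℂ) (hf : Function.Periodic f 1) (n : ℤ) :
    circleFourierCoeff (fun t => f (t - 1/2)) n = (-1) ^ n * circleFourierCoeff f n := by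
  unfold circleFourierCoeff
  have h1 : ∀ t : ℝ, f (t - 1/2) * Complex.exp (-2 * Real.pi * Complex.I * n * t) =
     (fun u : ℝ => (-1) ^ n * (f u * Complex.exp (-2 * Real.pi * Complex.I * n * u))) (t - 1/2) := by
    intro t
    simp only
    rw [← exp_half, mul_left_comm, ← Complex.exp_add]
    congr 2
    push_cast; ring
  simp_rw [h1]
  rw [intervalIntegral.integral_comp_sub_right (fun u : ℝ => (-1) ^ n * (f u * Complex.exp (-2 * Real.pi * Complex.I * n * u))), intervalIntegral.integral_const_mul]
  congr 1
  have hp : Function.Periodic (fun u : ℝ => f u * Complex.exp (-2 * Real.pi * Complex.I * n * u)) 1 := by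
    intro t
    simp only
    rw [hf t, exp_per]
  have := hp.intervalIntegral_add_eq (-(1/2)) 0
  rw [zero_add] at this
  rw [← this]
  norm_num

lemma coeff_one (n : ℤ) : circleFourierCoeff (fun _ => 1) n = if n = 0 then 1 else 0 := by
  unfold circleFourierCoeff
  split_ifs with h
  · simp [h]
  · simp only [one_mul]
    rw [integral_exp_mul_complex]
    · have := exp_per n 0
      simp at this
      simp [this]
    · simp [h, Complex.I_ne_zero]

lemma coeff_tri {w : ℝ} (h0 : 0 < w) (h1 : w ≤ 1 / 2) (n : ℤ) :
    circleFourierCoeff (fun t => (tri w t : ℂ)) n = ((if n = 0 then w ^ 2 else triS w n : ℝ) : ℂ) := by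
  set F : ℝ → ℂ := fun t => (tri w t : ℂ) * Complex.exp (-2 * Real.pi * Complex.I * n * t) with hF
  have hc : Continuous F := by
    have := tri_cont w
    fun_prop
  have hsplit : circleFourierCoeff (fun t => (tri w t : ℂ)) n
     = (∫ t in (0:ℝ)..w, F t) + (∫ t in w..(1-w), F t) + ∫ t in (1-w)..1, F t := by
    rw [intervalIntegral.integral_add_adjacent_intervals (hc.intervalIntegrable _ _)
      (hc.intervalIntegrable _ _), intervalIntegral.integral_add_adjacent_intervals
      (hc.intervalIntegrable _ _) (hc.intervalIntegrable _ _)]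
    rfl
  have i2 : (∫ t in w..(1-w), F t) = 0 := by
    rw [intervalIntegral.integral_congr (g := fun _ => 0), intervalIntegral.integral_zero]
    intro t ht
    rw [Set.uIcc_of_le (by linarith)] at ht
    have : tri w t = 0 := by
      unfold tri
      rw [distZ_eq (by linarith [ht.1]) (by linarith [ht.2])]
      apply max_eq_left
      have : w ≤ min t (1 - t) := le_min ht.1 (by linarith [ht.2])
      linarith
    simp [hF, this]
  have i1 : (∫ t in (0:ℝ)..w, F t) = ∫ t in (0:ℝ)..w, ((w:ℂ) - t) * Complex.exp (-2 * Real.pi * Complex.I * n * t) := by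
    apply intervalIntegral.integral_congr
    intro t ht
    rw [Set.uIcc_of_le (by linarith)] at ht
    have : tri w t = w - t := by
      unfold tri
      rw [distZ_eq (by linarith [ht.1]) (by linarith [ht.2]), min_eq_left (by linarith [ht.2])]
      apply max_eq_right
      linarith [ht.2]
    simp [hF, this]
  have i3 : (∫ t in (1-w)..1, F t) = ∫ t in (1-w)..1, ((w:ℂ) - 1 + t) * Complex.exp (-2 * Real.pi * Complex.I * n * t) := by
    apply intervalIntegral.integral_congr
    intro t ht
    rw [Set.uIcc_of_le (by linarith)] at ht
    have : tri w t = w - 1 + t := by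
      unfold tri
      rw [distZ_eq (by linarith [ht.1]) (by linarith [ht.2]), min_eq_right (by linarith [ht.1])]
      rw [max_eq_right]
      · ring
      linarith [ht.1]
    simp [hF, this]
  rw [hsplit, i2, i1, i3, add_zero]
  have hE : ∀ c : ℂ, ∀ t : ℝ, HasDerivAt (fun t : ℝ => Complex.exp (c * t)) (Complex.exp (c * t) * c) t := by
    intro c t
    have h := ((hasDerivAt_id (t:ℂ)).const_mul c).cexp.comp_ofReal
    simpa using h
  have hI : ∀ t : ℝ, HasDerivAt (fun t : ℝ => (t : ℂ)) 1 t := fun t => Complex.ofRealCLM.hasDerivAt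
  by_cases hn : n = 0
  · subst hn
    simp only [Int.cast_zero, mul_zero, zero_mul, Complex.exp_zero, mul_one, if_true]
    rw [intervalIntegral.integral_eq_sub_of_hasDerivAt (f := fun t : ℝ => (w:ℂ) * t - (t:ℂ)^2/2),
      intervalIntegral.integral_eq_sub_of_hasDerivAt (f := fun t : ℝ => ((w:ℂ)-1) * t + (t:ℂ)^2/2)]
    · push_cast; ring
    · intro t _
      have := ((hI t).const_mul ((w:ℂ)-1)).add (((hI t).pow 2).div_const 2)
      refine HasDerivAt.congr_deriv this ?_
      push_cast
      ring
    · exact Continuous.intervalIntegrable (by fun_prop) _ _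
    · intro t _
      have := ((hI t).const_mul (w:ℂ)).sub (((hI t).pow 2).div_const 2)
      refine HasDerivAt.congr_deriv this ?_
      push_cast
      ring
    · exact Continuous.intervalIntegrable (by fun_prop) _ _
  · rw [if_neg hn]
    set c : ℂ := -2 * Real.pi * Complex.I * n with hcdef
    have hc0 : c ≠ 0 := by simp [hcdef, hn, Complex.I_ne_zero]
    have hcs : c ^ 2 = -4 * (Real.pi:ℂ)^2 * (n:ℂ)^2 := by
      rw [hcdef]; ring_nf; rw [Complex.I_sq]; ring
    rw [intervalIntegral.integral_eq_sub_of_hasDerivAt (f := fun t : ℝ => Complex.exp (c * t) * (((w:ℂ) - t)/c + 1/c^2)),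
      intervalIntegral.integral_eq_sub_of_hasDerivAt (f := fun t : ℝ => Complex.exp (c * t) * (((w:ℂ) - 1 + t)/c - 1/c^2))]
    · have e1 : Complex.exp (c * (1:ℝ)) = 1 := by
        have := exp_per n 0
        rw [← hcdef, zero_add] at this
        rw [this]; simp
      have e2 : Complex.exp (c * (1 - w : ℝ)) = Complex.exp (-(c * w)) := by
        push_cast
        rw [mul_sub, sub_eq_add_neg, Complex.exp_add]
        simpa using e1
      have e3 : Complex.exp (c * w) + Complex.exp (-(c*w)) = 2 - 4 * (Real.sin (Real.pi * n * w) : ℂ)^2 := by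
        have : c * w = -(2 * (Real.pi * n * w)) * Complex.I := by rw [hcdef]; ring
        rw [this, show -(-(2 * (Real.pi * n * w : ℂ)) * Complex.I) = (2 * (Real.pi * n * w)) * Complex.I by ring, add_comm, ← Complex.two_cos, Complex.ofReal_sin, Complex.cos_two_mul, Complex.cos_sq']
        push_cast
        ring
      rw [e1, e2]
      have e4 : Complex.exp (c*w) = 2 - 4 * (Real.sin (Real.pi * n * w) : ℂ)^2 - Complex.exp (-(c*w)) := by
        rw [← e3]; ring
      rw [e4]
      unfold triS
      have hpi : (Real.pi : ℂ) ≠ 0 := by exact_mod_cast Real.pi_ne_zero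
      have hn' : (n : ℂ) ≠ 0 := by exact_mod_cast hn
      have : (((Real.sin (Real.pi * n * w))^2 / (Real.pi^2 * (n:ℝ)^2) : ℝ) : ℂ) = -4 * (Real.sin (Real.pi * n * w) : ℂ)^2 / c^2 := by
        rw [hcs]; push_cast; field_simp
      rw [this]
      push_cast
      simp only [mul_zero, Complex.exp_zero]
      field_simp
      ring
    · intro t _
      have := (hE c t).mul ((((hI t).const_add ((w:ℂ) - 1)).div_const c).sub_const (1/c^2))
      refine HasDerivAt.congr_deriv this ?_
      field_simp
      ring
    · exact Continuous.intervalIntegrable (by fun_prop) _ _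
    · intro t _
      have := (hE c t).mul ((((hI t).const_sub (w:ℂ)).div_const c).add_const (1/c^2))
      refine HasDerivAt.congr_deriv this ?_
      field_simp
      ring
    · exact Continuous.intervalIntegrable (by fun_prop) _ _

lemma coeff_sub_one (φ : ℝ → ℝ) (hφ : Continuous φ) (n : ℤ) :
    circleFourierCoeff (fun t => (φ t : ℂ) - 1) n =
      circleFourierCoeff (fun t => (φ t : ℂ)) n - if n = 0 then 1 else 0 := by
  rw [← coeff_one]
  unfold circleFourierCoeff
  rw [← intervalIntegral.integral_sub]
  · simp only [sub_mul]
  · exact Continuous.intervalIntegrable (by fun_prop) _ _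
  · exact Continuous.intervalIntegrable (by fun_prop) _ _

lemma key {h : ℝ} (h0 : 0 < h) (φ : ℝ → ℝ) (hφ : Continuous φ) (a b : ℤ → ℝ)
    (ha : ∀ n, circleFourierCoeff (fun t => (φ t : ℂ)) n = a n)
    (a0 : a 0 = 1) (apos : ∀ n, 0 ≤ a n) (ale : ∀ n, n ≠ 0 → a n ≤ 6 * h)
    (ab : ∀ n, n ≠ 0 → a n ≤ b n) (b0 : ∀ n, 0 ≤ b n) (B : ℝ) (hb : HasSum b B) (hB : B ≤ 6) :
    Summable (fun n : ℤ => ‖circleFourierCoeff (fun t => (φ t : ℂ)) n‖) ∧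
      circleFourierCoeff (fun t => (φ t : ℂ)) 0 = 1 ∧
      (∀ n : ℤ, (circleFourierCoeff (fun t => (φ t : ℂ)) n).im = 0 ∧
        0 ≤ (circleFourierCoeff (fun t => (φ t : ℂ)) n).re) ∧
      (∀ p : ℝ, 1 ≤ p →
        (∑' n : ℤ, ‖circleFourierCoeff (fun t => (φ t : ℂ) - 1) n‖ ^ p) ^ (1 / p) ≤
          6 * h ^ ((p - 1) / p)) := by
  refine ⟨?_, ?_, ?_, ?_⟩
  · have hs : Summable (fun n : ℤ => b n + if n = 0 then (1:ℝ) else 0) :=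
      hb.summable.add (hasSum_ite_eq (0:ℤ) (1:ℝ)).summable
    refine hs.of_nonneg_of_le (fun n => norm_nonneg _) ?_
    intro n
    rw [ha, Complex.norm_real, Real.norm_of_nonneg (apos n)]
    split_ifs with hn
    · subst hn; rw [a0]; linarith [b0 0]
    · linarith [ab n hn]
  · rw [ha, a0]; simp
  · intro n
    rw [ha]; exact ⟨Complex.ofReal_im _, by rw [Complex.ofReal_re]; exact apos n⟩
  · intro p hp
    have hp0 : 0 < p := by linarith
    have hle : ∀ n : ℤ, ‖circleFourierCoeff (fun t => (φ t : ℂ) - 1) n‖ ^ p ≤ (6 * h) ^ (p - 1) * b n := by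
      intro n
      rw [coeff_sub_one φ hφ, ha]
      split_ifs with hn
      · subst hn
        rw [a0]
        simp only [Complex.ofReal_one, sub_self, norm_zero]
        rw [Real.zero_rpow hp0.ne']
        have := b0 0
        positivity
      · rw [sub_zero, Complex.norm_real, Real.norm_of_nonneg (apos n)]
        calc a n ^ p = a n ^ ((p - 1) + 1) := by ring_nf
          _ = a n ^ (p-1) * a n := by
            rw [Real.rpow_add_of_nonneg (apos n) (by linarith) zero_le_one, Real.rpow_one]
          _ ≤ _ := by
            have := ale n hn
            have := ab n hn
            have := apos n
            have : 0 ≤ p - 1 := by linarith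
            gcongr
    have hsum := hb.summable.mul_left ((6 * h) ^ (p - 1))
    have hsum' : Summable fun n : ℤ => ‖circleFourierCoeff (fun t => (φ t : ℂ) - 1) n‖ ^ p :=
      hsum.of_nonneg_of_le (fun n => by positivity) hle
    have h1 : (∑' n : ℤ, ‖circleFourierCoeff (fun t => (φ t : ℂ) - 1) n‖ ^ p) ≤ (6 * h) ^ (p - 1) * 6 := by
      refine (hsum'.tsum_le_tsum hle hsum).trans ?_
      rw [tsum_mul_left, hb.tsum_eq]
      gcongr
    have h2 : (0:ℝ) ≤ ∑' n : ℤ, ‖circleFourierCoeff (fun t => (φ t : ℂ) - 1) n‖ ^ p :=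
      tsum_nonneg fun n => by positivity
    refine (Real.rpow_le_rpow h2 h1 (by positivity)).trans (le_of_eq ?_)
    have e : (6 * h) ^ (p - 1) * 6 = 6 ^ p * h ^ (p - 1) := by
      rw [Real.mul_rpow (by norm_num) h0.le, mul_right_comm]
      nth_rewrite 2 [← Real.rpow_one 6]
      rw [← Real.rpow_add (by norm_num)]
      ring_nf
    rw [e, Real.mul_rpow (by positivity) (by positivity), ← Real.rpow_mul (by norm_num),
      ← Real.rpow_mul h0.le, mul_one_div_cancel hp0.ne', Real.rpow_one, mul_one_div]

lemma case_large (h : ℝ) (h0 : 1 / 8 ≤ h) (h6 : h < 1 / 6) :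
    ∃ φ : ℝ → ℝ,
      Continuous φ ∧
      Function.Periodic φ 1 ∧
      (∀ t, 0 ≤ φ t) ∧
      Summable (fun n : ℤ => ‖circleFourierCoeff (fun t => (φ t : ℂ)) n‖) ∧
      circleFourierCoeff (fun t => (φ t : ℂ)) 0 = 1 ∧
      (∀ n : ℤ, (circleFourierCoeff (fun t => (φ t : ℂ)) n).im = 0 ∧
        0 ≤ (circleFourierCoeff (fun t => (φ t : ℂ)) n).re) ∧
      {t ∈ Set.Icc (0 : ℝ) 1 | φ t = 0} = Set.Icc (1 / 2 - h) (1 / 2 + h) ∧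
      (∀ p : ℝ, 1 ≤ p →
        (∑' n : ℤ, ‖circleFourierCoeff (fun t => (φ t : ℂ) - 1) n‖ ^ p) ^ (1 / p) ≤
          6 * h ^ ((p - 1) / p)) := by
  obtain ⟨w, rfl⟩ : ∃ w, h = 1 / 2 - w := ⟨1/2 - h, by ring⟩
  have w1 : 1 / 3 < w := by linarith
  have w2 : w ≤ 3 / 8 := by linarith
  have w0 : 0 < w := by linarith
  have hcont : Continuous (fun t => (1 / w ^ 2) * tri w t) := by
    have := tri_cont w
    fun_prop
  have K := key (h := 1/2 - w) (by linarith) (fun t => (1 / w ^ 2) * tri w t) hcont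
    (fun n => (1 / w^2) * if n = 0 then w ^ 2 else triS w n) (fun n => (1/w^2) * triS w n)
    ?_ ?_ ?_ ?_ ?_ ?_ ((1/w^2) * (w - w^2)) ((triS_hasSum w0.le (by linarith)).mul_left _) ?_
  · obtain ⟨k1, k2, k3, k4⟩ := K
    refine ⟨_, hcont, ?_, ?_, k1, k2, k3, ?_, k4⟩
    · intro t; simp only; rw [tri_periodic w t]
    · intro t; have := tri_nonneg w t; positivity
    · ext t
      have hne : 1 / w ^ 2 ≠ 0 := by positivity
      have hiff : t ∈ Set.Icc (0:ℝ) 1 → (tri w t = 0 ↔ w ≤ t ∧ t ≤ 1 - w) := by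
        intro ht
        unfold tri
        rw [distZ_eq ht.1 ht.2, max_eq_left_iff, sub_nonpos, le_min_iff]
        constructor <;> rintro ⟨a, b⟩ <;> constructor <;> linarith
      simp only [Set.mem_ofPred_eq, mul_eq_zero, hne, false_or]
      constructor
      · rintro ⟨ht, h⟩
        have := (hiff ht).1 h
        constructor <;> linarith [this.1, this.2]
      · rintro ⟨h1, h2⟩
        have ht : t ∈ Set.Icc (0:ℝ) 1 := ⟨by linarith, by linarith⟩
        exact ⟨ht, (hiff ht).2 ⟨by linarith, by linarith⟩⟩
  · intro n
    have := coeff_tri w0 (by linarith) n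
    rw [Complex.ofReal_mul, ← this]
    unfold circleFourierCoeff
    rw [← intervalIntegral.integral_const_mul]
    congr 1
    ext t
    push_cast
    ring
  · simp only [if_true]; field_simp
  · intro n
    have := triS_nonneg w n
    split_ifs <;> positivity
  · intro n hn
    simp only [if_neg hn]
    have hn2 : (1:ℝ) ≤ (n:ℝ)^2 := by
      have : (1:ℤ) ≤ n^2 := by have := sq_pos_of_ne_zero hn; omega
      exact_mod_cast this
    have hS : triS w n ≤ 1 / Real.pi^2 := by
      unfold triS
      have := Real.sin_sq_le_one (Real.pi * n * w)
      have hp := Real.pi_pos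
      gcongr
      nlinarith [sq_nonneg Real.pi]
    have hpi : 9.85 ≤ Real.pi^2 := by nlinarith [Real.pi_gt_d2]
    have hS2 : triS w n ≤ 1 / 9.85 := hS.trans (by gcongr)
    rw [one_div_mul_eq_div, div_le_iff₀ (by positivity)]
    refine hS2.trans ?_
    have : 0 ≤ (w - 1/3) * (3/8 - w) := mul_nonneg (by linarith) (by linarith)
    nlinarith
  · intro n hn
    simp only [if_neg hn]; exact le_rfl
  · intro n
    have := triS_nonneg w n
    positivity
  · rw [one_div_mul_eq_div, div_le_iff₀ (by positivity)]
    nlinarith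

lemma triS_sub (h : ℝ) (n : ℤ) : triS (2 * h) n - triS h n =
    Real.sin (Real.pi * n * (3 * h)) * Real.sin (Real.pi * n * h) /
      (Real.pi ^ 2 * (n : ℝ) ^ 2) := by
  unfold triS
  rw [← sub_div]
  congr 1
  set θ := Real.pi * n * h with hθ
  rw [show Real.pi * n * (2 * h) = 2 * θ by rw [hθ]; ring,
    show Real.pi * n * (3 * h) = 3 * θ by rw [hθ]; ring, Real.sin_two_mul, Real.sin_three_mul]
  have := Real.cos_sq' θ
  rw [mul_pow, this]
  ring

lemma small_eq {h : ℝ} (h0 : 0 < h) (n : ℤ) (ε : ℝ) (hε : ε ^ 2 = 1) :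
    1 / (6 * h) * triS (3 * h) n + 3 / (2 * h) * triS h n
      - 1 / h * (ε * (triS (2 * h) n - triS h n)) =
    (Real.sin (Real.pi * n * (3 * h)) - 3 * ε * Real.sin (Real.pi * n * h)) ^ 2 /
      (6 * h * (Real.pi ^ 2 * (n : ℝ) ^ 2)) := by
  rw [triS_sub]
  unfold triS
  rcases eq_or_ne (n : ℝ) 0 with hn | hn
  · simp [hn]
  have := Real.pi_ne_zero
  rw [sub_sq, mul_pow (3 * ε), mul_pow 3 ε, hε]
  field_simp
  ring

lemma case_small (h : ℝ) (h0 : 0 < h) (h8 : h ≤ 1 / 8) :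
    ∃ φ : ℝ → ℝ,
      Continuous φ ∧
      Function.Periodic φ 1 ∧
      (∀ t, 0 ≤ φ t) ∧
      Summable (fun n : ℤ => ‖circleFourierCoeff (fun t => (φ t : ℂ)) n‖) ∧
      circleFourierCoeff (fun t => (φ t : ℂ)) 0 = 1 ∧
      (∀ n : ℤ, (circleFourierCoeff (fun t => (φ t : ℂ)) n).im = 0 ∧
        0 ≤ (circleFourierCoeff (fun t => (φ t : ℂ)) n).re) ∧
      {t ∈ Set.Icc (0 : ℝ) 1 | φ t = 0} = Set.Icc (1 / 2 - h) (1 / 2 + h) ∧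
      (∀ p : ℝ, 1 ≤ p →
        (∑' n : ℤ, ‖circleFourierCoeff (fun t => (φ t : ℂ) - 1) n‖ ^ p) ^ (1 / p) ≤
          6 * h ^ ((p - 1) / p)) := by
  have c1 := tri_cont h
  have c2 := tri_cont (2 * h)
  have c3 := tri_cont (3 * h)
  set φ : ℝ → ℝ := fun t => 1 + 1 / (6 * h) * tri (3 * h) t + 3 / (2 * h) * tri h t
      - 1 / h * (tri (2 * h) (t - 1/2) - tri h (t - 1/2)) with hφ
  have hcont : Continuous φ := by fun_prop
  set a : ℤ → ℝ := fun n => if n = 0 then 1 else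
    1 / (6 * h) * triS (3 * h) n + 3 / (2 * h) * triS h n
      - 1 / h * ((-1) ^ n * (triS (2 * h) n - triS h n)) with ha
  have hε : ∀ n : ℤ, ((-1 : ℝ) ^ n) ^ 2 = 1 := by
    intro n
    rcases Int.even_or_odd n with hn | hn
    · simp [hn.neg_one_zpow]
    · simp [hn.neg_one_zpow]
  have ha' : ∀ n : ℤ, n ≠ 0 → a n =
      (Real.sin (Real.pi * n * (3 * h)) - 3 * (-1) ^ n * Real.sin (Real.pi * n * h)) ^ 2 /
      (6 * h * (Real.pi ^ 2 * (n : ℝ) ^ 2)) := by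
    intro n hn
    rw [ha]; simp only [if_neg hn]
    exact small_eq h0 n _ (hε n)
  have htrap : ∀ t, tri (2 * h) t - tri h t ≤ h := by
    intro t
    unfold tri
    have := distZ_nonneg t
    rcases max_cases 0 (2 * h - distZ t) with ⟨e, _⟩ | ⟨e, _⟩ <;>
    rcases max_cases 0 (h - distZ t) with ⟨e', _⟩ | ⟨e', _⟩ <;> rw [e, e'] <;> linarith
  have htrap1 : ∀ t, tri (2 * h) t - tri h t = h ↔ distZ t ≤ h := by
    intro t
    unfold tri
    have := distZ_nonneg t
    rcases max_cases 0 (2 * h - distZ t) with ⟨e, _⟩ | ⟨e, _⟩ <;>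
    rcases max_cases 0 (h - distZ t) with ⟨e', _⟩ | ⟨e', _⟩ <;> rw [e, e'] <;>
    constructor <;> intro _ <;> linarith
  have hφ' : ∀ t, φ t = 1 / (6 * h) * tri (3 * h) t + 3 / (2 * h) * tri h t
      + 1 / h * (h - (tri (2 * h) (t - 1/2) - tri h (t - 1/2))) := by
    intro t; rw [hφ]; field_simp; ring
  have hφ0 : ∀ t, φ t = 0 ↔ tri (3 * h) t = 0 ∧ tri h t = 0 ∧
      tri (2 * h) (t - 1/2) - tri h (t - 1/2) = h := by
    intro t
    have t1 := tri_nonneg (3 * h) t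
    have t2 := tri_nonneg h t
    have t3 := sub_nonneg.2 (htrap (t - 1/2))
    rw [hφ', add_eq_zero_iff_of_nonneg (by positivity) (by positivity),
      add_eq_zero_iff_of_nonneg (by positivity) (by positivity)]
    have q1 : 1 / (6 * h) ≠ 0 := by positivity
    have q2 : 3 / (2 * h) ≠ 0 := by positivity
    have q3 : 1 / h ≠ 0 := by positivity
    simp only [mul_eq_zero, q1, q2, q3, false_or, sub_eq_zero, and_assoc, eq_comm (a := h)]
  have K := key h0 φ hcont a (fun n => 1 / h * (1 / 3 * triS (3 * h) n + 3 * triS h n))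
    ?_ ?_ ?_ ?_ ?_ ?_ _
    ((((triS_hasSum (w := 3 * h) (by linarith) (by linarith)).mul_left (1 / 3)).add
      ((triS_hasSum (w := h) (by linarith) (by linarith)).mul_left 3)).mul_left (1 / h)) ?_
  · obtain ⟨k1, k2, k3, k4⟩ := K
    refine ⟨φ, hcont, ?_, ?_, k1, k2, k3, ?_, k4⟩
    · intro t
      rw [hφ]
      simp only
      rw [tri_periodic _ t, tri_periodic _ t, add_sub_right_comm t 1 (1 / 2), tri_periodic, tri_periodic]
    · intro t
      rw [hφ']
      have t1 := tri_nonneg (3 * h) t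
      have t2 := tri_nonneg h t
      have t3 := sub_nonneg.2 (htrap (t - 1/2))
      positivity
    · ext t
      simp only [Set.mem_ofPred_eq, hφ0, htrap1]
      constructor
      · rintro ⟨ht, _, _, h3⟩
        rw [distZ_half ht.1 ht.2, abs_le] at h3
        constructor <;> linarith [h3.1, h3.2]
      · rintro ⟨h1, h2⟩
        have ht : t ∈ Set.Icc (0:ℝ) 1 := ⟨by linarith, by linarith⟩
        have hd : 3 * h ≤ distZ t := by
          rw [distZ_eq ht.1 ht.2]; exact le_min (by linarith) (by linarith)
        refine ⟨ht, max_eq_left (by linarith), max_eq_left (by linarith), ?_⟩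
        rw [distZ_half ht.1 ht.2, abs_le]
        constructor <;> linarith
  · intro n
    have k3 := coeff_tri (w := 3 * h) (by linarith) (by linarith) n
    have k2 := coeff_tri (w := 2 * h) (by linarith) (by linarith) n
    have k1 := coeff_tri (w := h) (by linarith) (by linarith) n
    have m2 := coeff_shift (fun t => (tri (2 * h) t : ℂ))
      (fun t => by simp only; rw [tri_periodic]) n
    have m1 := coeff_shift (fun t => (tri h t : ℂ))
      (fun t => by simp only; rw [tri_periodic]) n
    have k0 := coeff_one n
    have lin : circleFourierCoeff (fun t => (φ t : ℂ)) n =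
        circleFourierCoeff (fun _ => 1) n
        + (1 / (6 * h) : ℝ) * circleFourierCoeff (fun t => (tri (3 * h) t : ℂ)) n
        + (3 / (2 * h) : ℝ) * circleFourierCoeff (fun t => (tri h t : ℂ)) n
        - (1 / h : ℝ) * (circleFourierCoeff (fun t => (tri (2 * h) (t - 1/2) : ℂ)) n
          - circleFourierCoeff (fun t => (tri h (t - 1/2) : ℂ)) n) := by
      unfold circleFourierCoeff
      rw [← intervalIntegral.integral_sub, ← intervalIntegral.integral_const_mul,
        ← intervalIntegral.integral_const_mul, ← intervalIntegral.integral_const_mul,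
        ← intervalIntegral.integral_add, ← intervalIntegral.integral_add,
        ← intervalIntegral.integral_sub]
      · congr 1
        ext t
        rw [hφ]
        push_cast
        ring
      all_goals exact Continuous.intervalIntegrable (by fun_prop) _ _
    rw [lin, m1, m2, k0, k1, k2, k3]
    rw [ha]
    by_cases hn : n = 0
    · subst hn
      have : (h : ℂ) ≠ 0 := by exact_mod_cast h0.ne'
      simp only [if_true, zpow_zero]
      push_cast
      field_simp
      ring
    · simp only [if_neg hn]
      push_cast
      ring
  · rw [ha]; simp
  · intro n
    by_cases hn : n = 0
    · rw [ha]; simp [hn]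
    · rw [ha' n hn]; positivity
  · intro n hn
    rw [ha' n hn]
    have hn' : (n:ℝ) ≠ 0 := by exact_mod_cast hn
    have hpi := Real.pi_pos
    rw [div_le_iff₀ (by positivity)]
    have e : |Real.sin (Real.pi * n * (3 * h)) - 3 * (-1) ^ n * Real.sin (Real.pi * n * h)| ≤
        |6 * (Real.pi * n * h)| := by
      refine (abs_sub _ _).trans ?_
      have a1 := Real.abs_sin_le_abs (x := Real.pi * n * (3 * h))
      have a2 := Real.abs_sin_le_abs (x := Real.pi * n * h)
      rw [show Real.pi * n * (3 * h) = 3 * (Real.pi * n * h) by ring] at a1 ⊢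
      rw [abs_mul 3] at a1
      rw [abs_mul (3 * _), abs_mul 3, abs_neg_one_zpow, abs_mul 6]
      rw [abs_of_pos (show (0:ℝ) < 3 by norm_num)] at *
      rw [abs_of_pos (show (0:ℝ) < 6 by norm_num)] at *
      linarith
    refine (sq_le_sq.2 e).trans (le_of_eq ?_)
    ring
  · intro n hn
    rw [ha' n hn]
    simp only [triS]
    have hn' : (n:ℝ) ≠ 0 := by exact_mod_cast hn
    have hpi := Real.pi_pos
    set x := Real.sin (Real.pi * n * (3 * h))
    set y := Real.sin (Real.pi * n * h)
    have e : 1 / h * (1 / 3 * (x ^ 2 / (Real.pi ^ 2 * (n:ℝ) ^ 2)) +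
        3 * (y ^ 2 / (Real.pi ^ 2 * (n:ℝ) ^ 2)))
        = (2 * x ^ 2 + 18 * y ^ 2) / (6 * h * (Real.pi ^ 2 * (n : ℝ) ^ 2)) := by
      field_simp
      ring
    rw [e]
    gcongr
    have h1 := hε n
    have h2 : 0 ≤ (x + 3 * (-1) ^ n * y) ^ 2 := sq_nonneg _
    have h3 : (3 * (-1) ^ n * y) ^ 2 = 9 * y ^ 2 := by rw [mul_pow, mul_pow, h1]; ring
    nlinarith
  · intro n
    have := triS_nonneg (3 * h) n
    have := triS_nonneg h n
    positivity
  · rw [one_div_mul_eq_div, div_le_iff₀ h0]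
    nlinarith

/-- **A nonnegative function on the circle with prescribed zero set and small
`A^p(𝕋)` distance to `1`.**
For `0 < h < 1/6` there is a nonnegative continuous `1`-periodic function `φ` with
absolutely convergent Fourier series such that `φ̂(0) = 1`, `φ̂(n) ≥ 0` for all `n`,
the zero set of `φ` in `[0,1]` is exactly `[1/2 - h, 1/2 + h]`, and
`‖φ - 1‖_{A^p(𝕋)} ≤ 6 h^{(p-1)/p}` for every `p ≥ 1`. -/
theorem exists_nonneg_circle_function_with_zero_interval
    (h : ℝ) (h0 : 0 < h) (h6 : h < 1 / 6) :
    ∃ φ : ℝ → ℝ,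
      Continuous φ ∧
      Function.Periodic φ 1 ∧
      (∀ t, 0 ≤ φ t) ∧
      Summable (fun n : ℤ => ‖circleFourierCoeff (fun t => (φ t : ℂ)) n‖) ∧
      circleFourierCoeff (fun t => (φ t : ℂ)) 0 = 1 ∧
      (∀ n : ℤ, (circleFourierCoeff (fun t => (φ t : ℂ)) n).im = 0 ∧
        0 ≤ (circleFourierCoeff (fun t => (φ t : ℂ)) n).re) ∧
      {t ∈ Set.Icc (0 : ℝ) 1 | φ t = 0} = Set.Icc (1 / 2 - h) (1 / 2 + h) ∧
      (∀ p : ℝ, 1 ≤ p →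
        (∑' n : ℤ, ‖circleFourierCoeff (fun t => (φ t : ℂ) - 1) n‖ ^ p) ^ (1 / p) ≤
          6 * h ^ ((p - 1) / p)) := by

  rcases le_total h (1 / 8) with h8 | h8
  · exact case_small h h0 h8
  · exact case_large h h8 h6
end
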